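/- There exist absolute constants c > 0 and C > 0 such that the following holds. Let p be a prime, let 0 < s < 1 and τ > 0 be reals, let Y ⊆ F_p with |Y| = p^τ, and for each y ∈ Y let X_y ⊆ F_p with |X_y| = p^s. Let Z = ⋃_{y ∈ Y} X_y × {y} ⊆ F_p^2, and let L be a set of affine lines in F_p^2 with |Y|·|L| ≤ c·p^2. If every point of Z is incident to at least p^s lines of L, then |L| ≥ C · p^{2s + τ/7}. -/

import Mathlib

/-- `ℓ ⊆ F^2` is an affine line if it is given by an equation `a x + b y = c`
with `(a, b) ≠ (0, 0)`. -/
def IsLine {F : Type*} [Field F] (ℓ : Set (F × F)) : Prop :=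
  ∃ a b c : F, (a ≠ 0 ∨ b ≠ 0) ∧ ℓ = {z : F × F | a * z.1 + b * z.2 = c}

/-- `nIncidences P L` is `I(P, L)`, the number of pairs `(z, ℓ) ∈ P × L` with `z ∈ ℓ`. -/
noncomputable def nIncidences {F : Type*} (P : Set (F × F)) (L : Set (Set (F × F))) : ℕ :=
  {zl : (F × F) × Set (F × F) | zl.1 ∈ P ∧ zl.2 ∈ L ∧ zl.1 ∈ zl.2}.ncard

open Finset in
/-- If each `a ∈ V` is related to at least `T` elements of `W`, then a greedily chosen subset of `W`
of size `k` meets the neighbourhood of every `a ∈ V` in more than `q` points. -/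
theorem exists_small_cover {α β : Type*} [DecidableEq β] (V : Finset α) (W : Finset β)
    (R : α → β → Prop) [∀ a, DecidablePred (R a)] (T q k : ℕ) (ρ : ℝ) (hT0 : 0 < T)
    (hT : ∀ a ∈ V, T ≤ #{b ∈ W | R a b}) (hq : 2 * q ≤ T) (hρ0 : 0 ≤ ρ) (hρ1 : ρ ≤ 1)
    (hρ : ρ * (4 * #W) ≤ T) (hk : #V * (1 - ρ) ^ k < (1 / 2 : ℝ) ^ q) :
    ∃ S ⊆ W, #S ≤ k ∧ ∀ a ∈ V, q < #{b ∈ S | R a b} := by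
  classical
  set Φ : Finset β → ℝ := fun S =>
    ∑ a ∈ V with #{b ∈ S | R a b} ≤ q, (1 / 2 : ℝ) ^ #{b ∈ S | R a b} with hΦ
  have step : ∀ n : ℕ, ∃ S ⊆ W, #S ≤ n ∧ Φ S ≤ #V * (1 - ρ) ^ n := by
    intro n
    induction n with
    | zero => exact ⟨∅, by simp, by simp, by simp [hΦ]⟩
    | succ n ih =>
      obtain ⟨S, hSW, hSn, hS⟩ := ih
      have hΦ0 : 0 ≤ Φ S := sum_nonneg fun a _ => by positivity
      rcases (W \ S).eq_empty_or_nonempty with hWS | hWS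
      · refine ⟨S, hSW, by omega, ?_⟩
        have : Φ S = 0 := by
          refine sum_eq_zero fun a ha => ?_
          exfalso
          simp only [mem_filter] at ha
          have hSeq : S = W := subset_antisymm hSW (sdiff_eq_empty_iff_subset.1 hWS)
          have h1 := hT a ha.1
          rw [hSeq] at ha
          omega
        rw [this]
        have : 0 ≤ 1 - ρ := by linarith
        positivity
      · suffices h : ∃ b ∈ W \ S, Φ (insert b S) ≤ (1 - ρ) * Φ S by
          obtain ⟨b, hb, hle⟩ := h
          rw [mem_sdiff] at hb
          refine ⟨insert b S, insert_subset hb.1 hSW, ?_, hle.trans ?_⟩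
          · rw [card_insert_of_notMem hb.2]; omega
          · have : 0 ≤ 1 - ρ := by linarith
            calc (1 - ρ) * Φ S ≤ (1 - ρ) * (#V * (1 - ρ) ^ n) := by gcongr
              _ = _ := by ring
        by_contra! hcon
        set V' := {a ∈ V | #{b ∈ S | R a b} ≤ q} with hV'
        have hdec : ∀ b ∈ W \ S, ∑ a ∈ V', (if R a b then (1 / 2 : ℝ) ^ #{b ∈ S | R a b} / 2 else 0)
            ≤ Φ S - Φ (insert b S) := by
          intro b hb
          rw [mem_sdiff] at hb
          have hcard : ∀ a, #{b' ∈ insert b S | R a b'} = #{b' ∈ S | R a b'} +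
              if R a b then 1 else 0 := by
            intro a
            rw [filter_insert]
            split_ifs with h
            · rw [card_insert_of_notMem (by simp [hb.2])]
            · rfl
          have h1 : Φ (insert b S) ≤ ∑ a ∈ V', (1 / 2 : ℝ) ^ #{b' ∈ insert b S | R a b'} := by
            refine sum_le_sum_of_subset_of_nonneg (fun a ha => ?_) fun _ _ _ => by positivity
            simp only [mem_filter, hV', hcard] at ha ⊢
            exact ⟨ha.1, by omega⟩
          have h2 : ∑ a ∈ V', (if R a b then (1 / 2 : ℝ) ^ #{b ∈ S | R a b} / 2 else 0) +
              ∑ a ∈ V', (1 / 2 : ℝ) ^ #{b' ∈ insert b S | R a b'} = Φ S := by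
            rw [← sum_add_distrib]
            refine sum_congr rfl fun a _ => ?_
            rw [hcard]
            split_ifs
            · rw [pow_succ]; ring
            · simp
          linarith
        have h1 : (T : ℝ) / 4 * Φ S ≤ ∑ b ∈ W \ S, (Φ S - Φ (insert b S)) := by
          refine le_trans ?_ (sum_le_sum hdec)
          rw [sum_comm, hΦ, mul_sum]
          refine sum_le_sum fun a ha => ?_
          rw [← sum_filter, sum_const, nsmul_eq_mul]
          simp only [mem_filter] at ha
          have h2 : T ≤ #{b ∈ W \ S | R a b} + #{b ∈ S | R a b} := by
            refine (hT a ha.1).trans ?_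
            rw [← card_union_of_disjoint]
            · refine card_le_card fun b hb => ?_
              simp only [mem_filter, mem_union, mem_sdiff] at hb ⊢
              tauto
            · rw [disjoint_left]
              intro b hb
              simp only [mem_filter, mem_sdiff] at hb ⊢
              tauto
          have h3 : T ≤ 2 * #{b ∈ W \ S | R a b} := by omega
          have h3' : (T : ℝ) ≤ 2 * #{b ∈ W \ S | R a b} := by exact_mod_cast h3
          have : (0 : ℝ) ≤ (1 / 2 : ℝ) ^ #{b ∈ S | R a b} := by positivity
          nlinarith
        have h2 : ∑ b ∈ W \ S, (Φ S - Φ (insert b S)) < ∑ b ∈ W \ S, ρ * Φ S :=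
          sum_lt_sum_of_nonempty hWS fun b hb => by linarith [hcon b hb]
        rw [sum_const, nsmul_eq_mul] at h2
        have h3 : (#(W \ S) : ℝ) ≤ #W := by exact_mod_cast card_le_card sdiff_subset
        have h4 : (#(W \ S) : ℝ) * (ρ * Φ S) ≤ #W * (ρ * Φ S) := by gcongr
        nlinarith
  obtain ⟨S, hSW, hSk, hS⟩ := step k
  refine ⟨S, hSW, hSk, fun a ha => ?_⟩
  by_contra! h
  have h1 : (1 / 2 : ℝ) ^ #{b ∈ S | R a b} ≤ Φ S :=
    single_le_sum (f := fun a => (1 / 2 : ℝ) ^ #{b ∈ S | R a b}) (fun _ _ => by positivity)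
      (by simp [ha, h])
  have h2 : (1 / 2 : ℝ) ^ q ≤ (1 / 2 : ℝ) ^ #{b ∈ S | R a b} :=
    pow_le_pow_of_le_one (by norm_num) (by norm_num) h
  linarith

open MvPolynomial in
theorem finrank_restrictDegree {K : Type*} [Field K] (σ : Type*) [Fintype σ] (D : ℕ) :
    Module.finrank K (restrictDegree σ K D) = (D + 1) ^ Fintype.card σ := by
  classical
  have e : {n : σ →₀ ℕ | ∀ i, n i ≤ D} ≃ (σ → Fin (D + 1)) :=
    { toFun := fun n i => ⟨n.1 i, Nat.lt_succ_of_le (n.2 i)⟩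
      invFun := fun v => ⟨Finsupp.equivFunOnFinite.symm fun i => (v i : ℕ),
        fun i => Nat.le_of_lt_succ (v i).2⟩
      left_inv := fun n => by ext i; simp
      right_inv := fun v => by ext i; simp }
  rw [restrictDegree, Module.finrank_eq_nat_card_basis (basisRestrictSupport K _),
    Nat.card_congr e]
  simp

open MvPolynomial in
theorem mem_restrictDegree_iff_degreeOf {K σ : Type*} [Field K] {f : MvPolynomial σ K} {D : ℕ} :
    f ∈ restrictDegree σ K D ↔ ∀ i, f.degreeOf i ≤ D := by
  simp only [mem_restrictDegree, degreeOf_le_iff]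
  exact ⟨fun h i s hs => h s hs i, fun h s hs i => h i s hs⟩

section Bezout

open MvPolynomial Finset

variable {K : Type*} [Field K]

/-- The restriction of a polynomial in three variables to the curve `u = α(v)`, `w = γ(v)`. -/
noncomputable def graphRestrict (ℓ : Polynomial K × Polynomial K) :
    MvPolynomial (Fin 3) K →ₐ[K] Polynomial K :=
  aeval ![ℓ.1, Polynomial.X, ℓ.2]

open Classical in
/-- A polynomial vanishing on the graph `m` but not on the different graph `ℓ`. -/
noncomputable def graphSeparator (ℓ m : Polynomial K × Polynomial K) : MvPolynomial (Fin 3) K :=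
  if ℓ.1 ≠ m.1 then X 0 - Polynomial.aeval (X 1) m.1 else X 2 - Polynomial.aeval (X 1) m.2

theorem graphRestrict_aeval (ℓ : Polynomial K × Polynomial K) (q : Polynomial K) :
    graphRestrict ℓ (Polynomial.aeval (X 1) q) = q := by
  rw [← Polynomial.aeval_algHom_apply]
  simp [graphRestrict]

theorem graphRestrict_separator_self (ℓ m : Polynomial K × Polynomial K) :
    graphRestrict m (graphSeparator ℓ m) = 0 := by
  unfold graphSeparator
  split_ifs <;> rw [map_sub, graphRestrict_aeval] <;> simp [graphRestrict]

theorem graphRestrict_separator_ne {ℓ m : Polynomial K × Polynomial K} (h : ℓ ≠ m) :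
    graphRestrict ℓ (graphSeparator ℓ m) ≠ 0 := by
  unfold graphSeparator
  split_ifs with h1 <;> rw [map_sub, graphRestrict_aeval] <;> simp only [graphRestrict, aeval_X]
  · simpa [sub_eq_zero] using h1
  · have : ℓ.2 ≠ m.2 := fun h2 => h (Prod.ext (by simpa using h1) h2)
    simpa [sub_eq_zero] using this

theorem degreeOf_aeval_X_le (q : Polynomial K) (i j : Fin 3) :
    degreeOf i (Polynomial.aeval (X j : MvPolynomial (Fin 3) K) q) ≤ q.natDegree := by
  rw [Polynomial.aeval_eq_sum_range]
  refine (degreeOf_sum_le _ _ _).trans (Finset.sup_le fun n hn => ?_)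
  rw [smul_eq_C_mul]
  refine (degreeOf_C_mul_le _ _ _).trans ((degreeOf_pow_le _ _ _).trans ?_)
  have : degreeOf i (X j : MvPolynomial (Fin 3) K) ≤ 1 := by
    classical rw [degreeOf_X]; split_ifs <;> simp
  have h2 := Finset.mem_range.1 hn
  nlinarith

theorem degreeOf_graphSeparator_le (ℓ : Polynomial K × Polynomial K)
    {m : Polynomial K × Polynomial K} (h1 : m.1.natDegree ≤ 1) (h2 : m.2.natDegree ≤ 1)
    (i : Fin 3) : degreeOf i (graphSeparator ℓ m) ≤ 1 := by
  have hX : ∀ j : Fin 3, degreeOf i (X j : MvPolynomial (Fin 3) K) ≤ 1 := by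
    intro j
    classical rw [degreeOf_X]; split_ifs <;> simp
  unfold graphSeparator
  split_ifs
  · exact (degreeOf_sub_le _ _ _).trans (max_le (hX 0) ((degreeOf_aeval_X_le _ _ _).trans h1))
  · exact (degreeOf_sub_le _ _ _).trans (max_le (hX 2) ((degreeOf_aeval_X_le _ _ _).trans h2))

/-- If `f ∣ ∑ j, g ^ j * ∑ i, e i * q j i (v)` where `f`, `g` vanish on the graphs in `S` and `e i`
vanishes on every graph in `S` except `i`, then all `q j i` vanish. -/
theorem eq_zero_of_dvd_sum_pow {f g : MvPolynomial (Fin 3) K} (hf : Prime f) (hfg : ¬ f ∣ g)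
    (S : Finset (Polynomial K × Polynomial K))
    (hfS : ∀ ℓ ∈ S, graphRestrict ℓ f = 0) (hgS : ∀ ℓ ∈ S, graphRestrict ℓ g = 0)
    (e : Polynomial K × Polynomial K → MvPolynomial (Fin 3) K)
    (he : ∀ ℓ ∈ S, graphRestrict ℓ (e ℓ) ≠ 0)
    (he' : ∀ ℓ ∈ S, ∀ m ∈ S, ℓ ≠ m → graphRestrict ℓ (e m) = 0)
    (J : ℕ) (q : ℕ → Polynomial K × Polynomial K → Polynomial K)
    (h : f ∣ ∑ j ∈ range J, g ^ j * ∑ ℓ ∈ S, e ℓ * Polynomial.aeval (X 1) (q j ℓ)) :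
    ∀ j < J, ∀ ℓ ∈ S, q j ℓ = 0 := by
  induction J generalizing q with
  | zero => simp
  | succ J ih =>
    rw [sum_range_succ'] at h
    simp only [pow_zero, one_mul, pow_succ', mul_assoc, ← mul_sum] at h
    have h0 : ∀ ℓ ∈ S, q 0 ℓ = 0 := by
      intro ℓ hℓ
      have h1 := map_dvd (graphRestrict ℓ) h
      rw [hfS ℓ hℓ, zero_dvd_iff, map_add, map_mul, hgS ℓ hℓ, zero_mul, zero_add, map_sum,
        sum_eq_single ℓ] at h1
      · rw [map_mul, graphRestrict_aeval] at h1
        exact (mul_eq_zero.1 h1).resolve_left (he ℓ hℓ)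
      · intro m hm hne
        rw [map_mul, he' ℓ hℓ m hm hne.symm, zero_mul]
      · exact fun h => (h hℓ).elim
    rw [sum_eq_zero (s := S) (fun ℓ hℓ => by rw [h0 ℓ hℓ, map_zero, mul_zero]), add_zero] at h
    have h2 := ih (fun j => q (j + 1)) ((hf.dvd_or_dvd h).resolve_left hfg)
    intro j hj ℓ hℓ
    cases j with
    | zero => exact h0 ℓ hℓ
    | succ j => exact h2 j (by omega) ℓ hℓ

theorem card_mul_le_of_graphs {f g : MvPolynomial (Fin 3) K} (hf : Prime f) (hfg : ¬ f ∣ g)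
    (S : Finset (Polynomial K × Polynomial K))
    (hS1 : ∀ ℓ ∈ S, ℓ.1.natDegree ≤ 1) (hS2 : ∀ ℓ ∈ S, ℓ.2.natDegree ≤ 1)
    (hfS : ∀ ℓ ∈ S, graphRestrict ℓ f = 0) (hgS : ∀ ℓ ∈ S, graphRestrict ℓ g = 0)
    (D J a : ℕ) (hfD : f.totalDegree ≤ D) (hD : J * g.totalDegree + #S + a ≤ D) :
    (D - f.totalDegree + 1) ^ 3 + J * (#S * a) ≤ (D + 1) ^ 3 := by
  classical
  set e : Polynomial K × Polynomial K → MvPolynomial (Fin 3) K :=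
    fun ℓ => ∏ m ∈ S.erase ℓ, graphSeparator ℓ m with he
  have he0 : ∀ ℓ ∈ S, graphRestrict ℓ (e ℓ) ≠ 0 := by
    intro ℓ _
    rw [he, map_prod, prod_ne_zero_iff]
    exact fun m hm => graphRestrict_separator_ne (ne_of_mem_erase hm).symm
  have he1 : ∀ ℓ ∈ S, ∀ m ∈ S, ℓ ≠ m → graphRestrict ℓ (e m) = 0 := by
    intro ℓ hℓ m _ hne
    rw [he, map_prod]
    exact prod_eq_zero (mem_erase.2 ⟨hne, hℓ⟩) (graphRestrict_separator_self _ _)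
  have hedeg : ∀ ℓ, ∀ i, degreeOf i (e ℓ) ≤ #S := by
    intro ℓ i
    refine (degreeOf_prod_le _ _ _).trans ((sum_le_card_nsmul _ _ 1 fun m hm =>
      degreeOf_graphSeparator_le _ (hS1 m (mem_of_mem_erase hm)) (hS2 m (mem_of_mem_erase hm)) i
      ).trans ?_)
    simpa using card_le_card (erase_subset ℓ S)
  set ψ : restrictDegree (Fin 3) K (D - f.totalDegree) ×
      (Fin J → S → Polynomial.degreeLT K a) →ₗ[K] MvPolynomial (Fin 3) K :=
    LinearMap.coprod (LinearMap.mulLeft K f ∘ₗ Submodule.subtype _)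
      (∑ j : Fin J, ∑ ℓ : S, LinearMap.mulLeft K (g ^ (j : ℕ) * e ℓ) ∘ₗ
        (Polynomial.aeval (X 1 : MvPolynomial (Fin 3) K)).toLinearMap ∘ₗ
        Submodule.subtype _ ∘ₗ LinearMap.proj ℓ ∘ₗ LinearMap.proj j) with hψ
  have hψa : ∀ x, ψ x = f * x.1.1 + ∑ j : Fin J, ∑ ℓ : S,
      g ^ (j : ℕ) * e ℓ * Polynomial.aeval (X 1) (x.2 j ℓ).1 := by
    intro x
    simp [hψ, LinearMap.sum_apply, mul_assoc]
  have hinj : Function.Injective ψ := by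
    rw [← LinearMap.ker_eq_bot, LinearMap.ker_eq_bot']
    intro x hx
    rw [hψa] at hx
    set q : ℕ → Polynomial K × Polynomial K → Polynomial K := fun j ℓ =>
      if h : j < J ∧ ℓ ∈ S then (x.2 ⟨j, h.1⟩ ⟨ℓ, h.2⟩).1 else 0 with hq
    have hsum : ∑ j : Fin J, ∑ ℓ : S, g ^ (j : ℕ) * e ℓ * Polynomial.aeval (X 1) (x.2 j ℓ).1 =
        ∑ j ∈ range J, g ^ j * ∑ ℓ ∈ S, e ℓ * Polynomial.aeval (X 1) (q j ℓ) := by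
      rw [sum_range]
      refine sum_congr rfl fun j _ => ?_
      rw [← sum_coe_sort S, mul_sum]
      refine sum_congr rfl fun ℓ _ => ?_
      simp [hq, mul_assoc]
    rw [hsum] at hx
    have hq0 := eq_zero_of_dvd_sum_pow hf hfg S hfS hgS e he0 he1 J q
      ⟨-x.1.1, by linear_combination hx⟩
    have h2 : x.2 = 0 := by
      ext j ℓ : 3
      have := hq0 j j.2 ℓ ℓ.2
      simpa [hq] using this
    have h1 : x.1 = 0 := by
      rw [sum_eq_zero (fun j hj => by
        rw [sum_eq_zero (fun ℓ hℓ => by rw [hq0 j (mem_range.1 hj) ℓ hℓ, map_zero, mul_zero]),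
          mul_zero]), add_zero] at hx
      exact Subtype.ext ((mul_eq_zero.1 hx).resolve_left hf.ne_zero)
    exact Prod.ext h1 h2
  have hrange : ∀ x, ψ x ∈ restrictDegree (Fin 3) K D := by
    intro x
    rw [hψa]
    refine Submodule.add_mem _ ?_ (Submodule.sum_mem _ fun j _ => Submodule.sum_mem _ fun ℓ _ => ?_)
    · rw [mem_restrictDegree_iff_degreeOf]
      intro i
      have h1 := degreeOf_mul_le i f x.1.1
      have h2 := mem_restrictDegree_iff_degreeOf.1 x.1.2 i
      have h3 := degreeOf_le_totalDegree f i
      omega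
    · rw [mem_restrictDegree_iff_degreeOf]
      intro i
      have h1 := degreeOf_mul_le i (g ^ (j : ℕ) * e ℓ) (Polynomial.aeval (X 1) (x.2 j ℓ).1)
      have h2 := degreeOf_mul_le i (g ^ (j : ℕ)) (e ℓ)
      have h3 := degreeOf_pow_le i g j
      have h4 := degreeOf_le_totalDegree g i
      have h5 := hedeg ℓ i
      have h6 := degreeOf_aeval_X_le (x.2 j ℓ).1 i 1
      have h7 : (x.2 j ℓ).1.natDegree ≤ a := by
        have := Polynomial.mem_degreeLT.1 (x.2 j ℓ).2
        exact Polynomial.natDegree_le_of_degree_le this.le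
      have h8 : (j : ℕ) * degreeOf i g ≤ J * g.totalDegree := Nat.mul_le_mul j.2.le h4
      omega
  have hfin := LinearMap.finrank_le_finrank_of_injective
    (f := ψ.codRestrict (restrictDegree (Fin 3) K D) hrange)
    fun x y h => hinj (congrArg Subtype.val h)
  have hlt : Module.finrank K (Polynomial.degreeLT K a) = a := by
    rw [LinearEquiv.finrank_eq (Polynomial.degreeLTEquiv K a)]; simp
  have : Module.Finite K (Polynomial.degreeLT K a) :=
    Module.Finite.equiv (Polynomial.degreeLTEquiv K a).symm
  rw [Module.finrank_prod, finrank_restrictDegree, finrank_restrictDegree,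
    Module.finrank_pi_fintype] at hfin
  simp only [Module.finrank_pi_fintype, hlt, sum_const, card_univ, Fintype.card_fin,
    Fintype.card_coe, smul_eq_mul] at hfin
  exact hfin

/-- A Bézout-type bound for the number of lines contained in two surfaces. -/
theorem card_graphs_le {f g : MvPolynomial (Fin 3) K} (hf : Prime f) (hfg : ¬ f ∣ g)
    (S : Finset (Polynomial K × Polynomial K))
    (hS1 : ∀ ℓ ∈ S, ℓ.1.natDegree ≤ 1) (hS2 : ∀ ℓ ∈ S, ℓ.2.natDegree ≤ 1)
    (hfS : ∀ ℓ ∈ S, graphRestrict ℓ f = 0) (hgS : ∀ ℓ ∈ S, graphRestrict ℓ g = 0) :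
    #S ≤ 27 * f.totalDegree * g.totalDegree := by
  rcases Nat.eq_zero_or_pos g.totalDegree with hg | hg
  · rw [hg, mul_zero, Nat.le_zero, card_eq_zero, eq_empty_iff_forall_notMem]
    intro ℓ hℓ
    have h := hgS ℓ hℓ
    rw [totalDegree_eq_zero_iff_eq_C.1 hg] at h hfg
    have : coeff 0 g = 0 := by simpa [graphRestrict] using h
    exact hfg (by simp [this])
  have hd : 0 < f.totalDegree := by
    by_contra! h
    have h0 := totalDegree_eq_zero_iff_eq_C.1 (Nat.le_zero.1 h)
    apply hf.not_isUnit
    rw [h0] at hf ⊢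
    exact (IsUnit.mk0 _ fun h => hf.ne_zero (by rw [h, C_0])).map C
  set d := f.totalDegree
  set e := g.totalDegree
  set M := #S with hM
  set Y := e * (M + 1) with hY
  have hYM : M + 1 ≤ Y := by nlinarith
  rcases lt_or_ge (2 * Y + M) d with h | h
  · nlinarith
  · have key := card_mul_le_of_graphs hf hfg S hS1 hS2 hfS hgS (2 * Y + M) (M + 1) Y h
      (by rw [hY]; nlinarith)
    obtain ⟨t, ht⟩ := Nat.exists_eq_add_of_le h
    change (2 * Y + M - d + 1) ^ 3 + (M + 1) * (M * Y) ≤ (2 * Y + M + 1) ^ 3 at key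
    rw [ht, Nat.add_sub_cancel_left] at key
    have h1 : (M + 1) * (M * Y) ≤ 3 * d * (2 * Y + M + 1) ^ 2 := by
      have h2 : 3 * d * (d + t + 1) ^ 2 + (t + 1) ^ 3 =
          (d + t + 1) ^ 3 + (3 * d ^ 2 * (t + 1) + 2 * d ^ 3) := by ring
      rw [ht]; omega
    have h2 : (2 * Y + M + 1) ^ 2 ≤ (3 * Y) ^ 2 := Nat.pow_le_pow_left (by omega) 2
    have h3 : (Y * (M + 1)) * M ≤ (Y * (M + 1)) * (27 * d * e) := by
      calc (Y * (M + 1)) * M = (M + 1) * (M * Y) := by ring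
        _ ≤ 3 * d * (3 * Y) ^ 2 := h1.trans (Nat.mul_le_mul_left _ h2)
        _ = 27 * d * Y * Y := by ring
        _ = 27 * d * (e * (M + 1)) * Y := by rw [← hY]
        _ = _ := by ring
    exact Nat.le_of_mul_le_mul_left h3 (by positivity)

end Bezout

namespace Polynomial

variable {K : Type*} [Field K]

theorem natDegree_eq_zero_of_derivative_of_le {q : K[X]} {n : ℕ}
    (hn : ∀ m : ℕ, 0 < m → m ≤ n → (m : K) ≠ 0) (hq : q.natDegree ≤ n) (h : derivative q = 0) :
    q.natDegree = 0 := by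
  by_contra h0
  obtain ⟨m, hm⟩ := Nat.exists_eq_succ_of_ne_zero h0
  have h1 := congrArg (fun r => r.coeff m) h
  simp only [coeff_derivative, coeff_zero] at h1
  rcases mul_eq_zero.1 h1 with h2 | h2
  · have : q.leadingCoeff = 0 := by rw [leadingCoeff, hm]; exact h2
    rw [leadingCoeff_eq_zero] at this
    simp [this] at h0
  · exact hn (m + 1) (by omega) (by omega) (by exact_mod_cast h2)

/-- Two polynomials of small degree with vanishing Wronskian are proportional. -/
theorem exists_eq_C_mul_of_wronskian_eq_zero {A B : K[X]} {n : ℕ}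
    (hn : ∀ m : ℕ, 0 < m → m ≤ n → (m : K) ≠ 0) (hA : A.natDegree ≤ n) (hB : B.natDegree ≤ n)
    (hB0 : B ≠ 0) (h : derivative A * B = A * derivative B) : ∃ κ : K, A = C κ * B := by
  obtain ⟨a, b, g, hco, rfl, rfl⟩ : ∃ a b g : K[X], IsCoprime a b ∧ A = g * a ∧ B = g * b := by
    classical
    let := UniqueFactorizationMonoid.toGCDMonoid K[X]
    obtain ⟨a, b, h1, h2, hab⟩ := extract_gcd A B
    exact ⟨a, b, gcd A B, (gcd_isUnit_iff _ _).1 hab, h1, h2⟩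
  have hg : g ≠ 0 := left_ne_zero_of_mul hB0
  have hb : b ≠ 0 := right_ne_zero_of_mul hB0
  have h' : derivative a * b = a * derivative b := by
    simp only [derivative_mul] at h
    have : g ^ 2 * (derivative a * b) = g ^ 2 * (a * derivative b) := by linear_combination h
    exact mul_left_cancel₀ (pow_ne_zero 2 hg) this
  have hb' : derivative b = 0 := by
    have hdvd : b ∣ derivative b := hco.symm.dvd_of_dvd_mul_left ⟨derivative a, by rw [← h', mul_comm]⟩
    by_contra hne
    have h1 := natDegree_le_of_dvd hdvd hne
    have h2 := natDegree_derivative_le b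
    rcases Nat.eq_zero_or_pos b.natDegree with h3 | h3
    · exact hne (derivative_of_natDegree_zero h3)
    · omega
  have ha' : derivative a = 0 := by
    rw [hb', mul_zero] at h'
    exact (mul_eq_zero.1 h').resolve_right hb
  rw [natDegree_mul hg hb] at hB
  have hb0 := natDegree_eq_zero_of_derivative_of_le hn (by omega) hb'
  rcases eq_or_ne a 0 with rfl | ha
  · exact ⟨0, by simp⟩
  rw [natDegree_mul hg ha] at hA
  have ha0 := natDegree_eq_zero_of_derivative_of_le hn (by omega) ha'
  obtain ⟨α, rfl⟩ := natDegree_eq_zero.1 ha0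
  obtain ⟨β, rfl⟩ := natDegree_eq_zero.1 hb0
  have hβ : β ≠ 0 := by simpa using hb
  refine ⟨α / β, ?_⟩
  rw [mul_left_comm, ← C_mul, div_mul_cancel₀ _ hβ]

/-- A projective version: `e (e a'' - a e'') = 2 e' (e a' - a e')` says that the second derivative
of `a / e` vanishes. -/
theorem exists_eq_linear_mul {a e : K[X]} {n : ℕ}
    (hn : ∀ m : ℕ, 0 < m → m ≤ 2 * n + 1 → (m : K) ≠ 0) (ha : a.natDegree ≤ n)
    (he : e.natDegree ≤ n) (he0 : e ≠ 0)
    (h : e * (e * derivative (derivative a) - a * derivative (derivative e)) =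
      2 * derivative e * (e * derivative a - a * derivative e)) :
    ∃ κ μ : K, a = (C κ * X + C μ) * e := by
  obtain ⟨κ, hκ⟩ := exists_eq_C_mul_of_wronskian_eq_zero
    (A := e * derivative a - a * derivative e) (B := e ^ 2) hn
    (by
      have h1 := natDegree_derivative_le a
      have h2 := natDegree_derivative_le e
      refine (natDegree_sub_le _ _).trans (max_le ?_ ?_) <;>
        refine natDegree_mul_le.trans ?_ <;> omega)
    (by refine natDegree_pow_le.trans ?_; omega) (pow_ne_zero 2 he0)
    (by
      simp only [derivative_sub, derivative_mul, derivative_pow]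
      simp only [Nat.cast_ofNat, map_ofNat, Nat.add_one_sub_one, pow_one]
      linear_combination e * h)
  obtain ⟨μ, hμ⟩ := exists_eq_C_mul_of_wronskian_eq_zero
    (A := a - C κ * X * e) (B := e) (n := 2 * n + 1) hn
    (by
      refine (natDegree_sub_le _ _).trans (max_le (by omega) ?_)
      have h1 : (C κ * X : K[X]).natDegree ≤ 1 := natDegree_C_mul_le _ _ |>.trans natDegree_X_le
      refine natDegree_mul_le.trans ?_
      omega)
    (by omega) he0
    (by
      simp only [derivative_sub, derivative_mul, derivative_C, derivative_X]
      linear_combination hκ)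
  exact ⟨κ, μ, by linear_combination hμ⟩

end Polynomial

namespace MvPolynomial

variable {K σ : Type*} [Field K]

theorem pderiv_comm (i j : σ) (f : MvPolynomial σ K) :
    pderiv i (pderiv j f) = pderiv j (pderiv i f) := by
  classical
  induction f using MvPolynomial.induction_on with
  | C a => simp
  | add p q hp hq => simp [hp, hq]
  | mul_X p n hp =>
    simp only [pderiv_mul, map_add, hp, pderiv_X, Pi.single_apply]
    split_ifs <;> simp; ring

theorem totalDegree_pderiv_le (i : σ) (f : MvPolynomial σ K) :
    (pderiv i f).totalDegree ≤ f.totalDegree - 1 := by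
  classical
  rw [totalDegree, Finset.sup_le_iff]
  intro m hm
  rw [mem_support_iff, coeff_pderiv] at hm
  have h1 := le_totalDegree (mem_support_iff.2 (left_ne_zero_of_mul hm))
  rw [Finsupp.sum_add_index' (fun _ => rfl) (fun _ _ _ => rfl), Finsupp.sum_single_index rfl] at h1
  omega

theorem totalDegree_eq_zero_of_pderiv {f : MvPolynomial σ K} {n : ℕ}
    (hn : ∀ m : ℕ, 0 < m → m ≤ n → (m : K) ≠ 0) (hf : f.totalDegree ≤ n)
    (h : ∀ i, pderiv i f = 0) : f.totalDegree = 0 := by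
  classical
  rw [← Nat.le_zero, totalDegree, Finset.sup_le_iff]
  intro m hm
  suffices m = 0 by simp [this]
  ext i
  by_contra hi
  simp only [Finsupp.coe_zero, Pi.zero_apply] at hi
  have h1 := congrArg (coeff (m - Finsupp.single i 1)) (h i)
  have h2 : m - Finsupp.single i 1 + Finsupp.single i 1 = m := by
    apply tsub_add_cancel_of_le
    rw [Finsupp.single_le_iff]
    omega
  rw [coeff_pderiv, h2, coeff_zero] at h1
  have h3 : ((m - Finsupp.single i 1 : σ →₀ ℕ) i + 1 : K) = (m i : ℕ) := by
    rw [Finsupp.tsub_apply, Finsupp.single_eq_same]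
    obtain ⟨r, hr⟩ := Nat.exists_eq_succ_of_ne_zero hi
    rw [hr]; simp
  rw [h3] at h1
  rcases mul_eq_zero.1 h1 with h4 | h4
  · exact mem_support_iff.1 hm h4
  · have h5 : m i ≤ n := by
      refine le_trans ?_ hf
      exact (monomial_le_degreeOf i hm).trans (degreeOf_le_totalDegree f i)
    exact hn _ (by omega) h5 h4

theorem derivative_aeval [Fintype σ] (φ : σ → Polynomial K) (f : MvPolynomial σ K) :
    Polynomial.derivative (aeval φ f) =
      ∑ i, aeval φ (pderiv i f) * Polynomial.derivative (φ i) := by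
  classical
  induction f using MvPolynomial.induction_on with
  | C a => simp [Polynomial.algebraMap_eq]
  | add p q hp hq => simp [hp, hq, add_mul, Finset.sum_add_distrib]
  | mul_X p n hp =>
    have h1 : ∀ i, aeval φ (pderiv i (p * X n)) * Polynomial.derivative (φ i) =
        aeval φ (pderiv i p) * Polynomial.derivative (φ i) * φ n +
          if i = n then aeval φ p * Polynomial.derivative (φ n) else 0 := by
      intro i
      rw [pderiv_mul, pderiv_X, map_add, map_mul, map_mul, aeval_X, Pi.single_apply]
      rcases eq_or_ne n i with rfl | h
      · rw [if_pos rfl, if_pos rfl, map_one]; ring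
      · rw [if_neg h, if_neg h.symm, map_zero]; ring
    rw [Finset.sum_congr rfl fun i _ => h1 i, Finset.sum_add_distrib, ← Finset.sum_mul, ← hp,
      Finset.sum_ite_eq' Finset.univ n, if_pos (Finset.mem_univ n), map_mul, aeval_X,
      Polynomial.derivative_mul]

end MvPolynomial

section LocalAnalysis

open MvPolynomial

variable {K : Type*} [Field K]

/-- The line `t ↦ (b - y x + y² t, t, x - y t)` attached to `(b, x, y)`. -/
noncomputable def lineOne (v : K × K × K) : Polynomial K × Polynomial K :=
  (Polynomial.C (v.1 - v.2.2 * v.2.1) + Polynomial.C (v.2.2 ^ 2) * Polynomial.X,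
    Polynomial.C v.2.1 - Polynomial.C v.2.2 * Polynomial.X)

/-- Restriction to the line `t ↦ (b - y x + y² t, t, x - y t)`. -/
noncomputable def restrictOne (v : K × K × K) : MvPolynomial (Fin 3) K →ₐ[K] Polynomial K :=
  graphRestrict (lineOne v)

/-- Restriction to the line `t ↦ (t, b - y x + y² t, x - y t)`. -/
noncomputable def restrictTwo (v : K × K × K) : MvPolynomial (Fin 3) K →ₐ[K] Polynomial K :=
  aeval ![Polynomial.X, (lineOne v).1, (lineOne v).2]

/-- The slope-type parameter governing the position of the crossing point. -/
def crossSlope (v v' : K × K × K) : K := v'.2.2 / (1 - v.2.2 * v'.2.2)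

/-- The parameter, on the first line of `v`, of its crossing with the second line of `v'`. -/
def crossParam (v v' : K × K × K) : K := v'.1 - crossSlope v v' * (v.2.1 - v.2.2 * v'.1)

/-- The first line of `v` crosses the second line of `v'` in a single point. -/
def Crosses (v v' : K × K × K) : Prop :=
  v'.2.2 ≠ 0 ∧ 1 - v.2.2 * v'.2.2 ≠ 0 ∧ v.2.1 - v.2.2 * v'.1 = v'.2.1 - v'.2.2 * v.1

theorem eval_restrictOne_eq {v v' : K × K × K} (h : Crosses v v') (F : MvPolynomial (Fin 3) K) :
    (restrictOne v F).eval (crossParam v v') = (restrictTwo v' F).eval (crossParam v' v) := by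
  obtain ⟨b, x, y⟩ := v
  obtain ⟨b', x', y'⟩ := v'
  obtain ⟨-, h1, h2⟩ := h
  simp only at h1 h2
  have h1' : 1 - y' * y ≠ 0 := by rwa [mul_comm]
  obtain rfl : x' = x - y * b' + y' * b := by linear_combination -h2
  have key : (Polynomial.aeval (crossParam (b, x, y) (b', x - y * b' + y' * b, y'))).comp
        (restrictOne (b, x, y)) =
      (Polynomial.aeval (crossParam (b', x - y * b' + y' * b, y') (b, x, y))).comp
        (restrictTwo (b', x - y * b' + y' * b, y')) := by
    apply MvPolynomial.algHom_ext
    intro i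
    fin_cases i
    · simp [restrictOne, restrictTwo, graphRestrict, lineOne, crossParam, crossSlope]
      field_simp
      ring
    · simp [restrictOne, restrictTwo, graphRestrict, lineOne, crossParam, crossSlope]
      field_simp
      ring
    · simp [restrictOne, restrictTwo, graphRestrict, lineOne, crossParam, crossSlope]
      field_simp
      ring
  exact DFunLike.congr_fun key F

/-- Differentiation along the first line. -/
noncomputable def dirOne (y : K) (F : MvPolynomial (Fin 3) K) : MvPolynomial (Fin 3) K :=
  C y ^ 2 * pderiv 0 F + pderiv 1 F - C y * pderiv 2 F

/-- Differentiation along the second line. -/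
noncomputable def dirTwo (y : K) (F : MvPolynomial (Fin 3) K) : MvPolynomial (Fin 3) K :=
  pderiv 0 F + C y ^ 2 * pderiv 1 F - C y * pderiv 2 F

theorem derivative_restrictOne (v : K × K × K) (F : MvPolynomial (Fin 3) K) :
    Polynomial.derivative (restrictOne v F) = restrictOne v (dirOne v.2.2 F) := by
  rw [restrictOne, graphRestrict, derivative_aeval, Fin.sum_univ_three]
  simp [lineOne, dirOne, Polynomial.algebraMap_eq, Polynomial.derivative_pow]
  ring

theorem derivative_restrictTwo (v : K × K × K) (F : MvPolynomial (Fin 3) K) :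
    Polynomial.derivative (restrictTwo v F) = restrictTwo v (dirTwo v.2.2 F) := by
  rw [restrictTwo, derivative_aeval, Fin.sum_univ_three]
  simp [lineOne, dirTwo, Polynomial.algebraMap_eq, Polynomial.derivative_pow]
  ring

/-- The coefficient of `θ` in the remainder of `a³ (h₄ θ⁴ + h₃ θ³ + h₂ θ² + h₁ θ + h₀)` modulo
`a θ² - c θ + b`. -/
def remOne {R : Type*} [CommRing R] (a b c h4 h3 h2 h1 : R) : R :=
  h4 * (c ^ 3 - 2 * a * b * c) + h3 * (a * (c ^ 2 - a * b)) + h2 * (a ^ 2 * c) + h1 * a ^ 3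

/-- The constant coefficient in the remainder of `a³ (h₄ θ⁴ + h₃ θ³ + h₂ θ² + h₁ θ + h₀)` modulo
`a θ² - c θ + b`. -/
def remZero {R : Type*} [CommRing R] (a b c h4 h3 h2 h0 : R) : R :=
  h0 * a ^ 3 - h4 * (b * (c ^ 2 - a * b)) - h3 * (a * b * c) - h2 * (a ^ 2 * b)

theorem remOne_eq_zero {a b c h4 h3 h2 h1 h0 y z : K} (hz : z ≠ 0) (hyz : 1 - y * z ≠ 0)
    (g1 : y ^ 2 * a + b - y * c = 0) (g2 : a + z ^ 2 * b - z * c = 0)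
    (H1 : h4 * y ^ 4 + h3 * y ^ 3 + h2 * y ^ 2 + h1 * y + h0 = 0)
    (H2 : h4 + h3 * z + h2 * z ^ 2 + h1 * z ^ 3 + h0 * z ^ 4 = 0) :
    remOne a b c h4 h3 h2 h1 = 0 := by
  have e1 : y * remOne a b c h4 h3 h2 h1 + remZero a b c h4 h3 h2 h0 = 0 := by
    unfold remOne remZero
    linear_combination a ^ 3 * H1 - (a ^ 2 * h4 * y ^ 2 + (a ^ 2 * h3 + a * c * h4) * y +
      (a ^ 2 * h2 + a * c * h3 + (c ^ 2 - a * b) * h4)) * g1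
  have e2 : z ^ 3 * (remOne a b c h4 h3 h2 h1 + z * remZero a b c h4 h3 h2 h0) = 0 := by
    unfold remOne remZero
    linear_combination a ^ 3 * H2 - (a ^ 2 * h4 + (a ^ 2 * h3 + a * c * h4) * z +
      (a ^ 2 * h2 + a * c * h3 + (c ^ 2 - a * b) * h4) * z ^ 2) * g2
  have e3 := (mul_eq_zero.1 e2).resolve_left (pow_ne_zero 3 hz)
  have e4 : (1 - y * z) * remOne a b c h4 h3 h2 h1 = 0 := by linear_combination e3 - z * e1
  exact (mul_eq_zero.1 e4).resolve_left hyz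

/-- `remOne` applied to the first and second derivatives of `f`. -/
noncomputable def hessOne (f : MvPolynomial (Fin 3) K) : MvPolynomial (Fin 3) K :=
  remOne (pderiv 0 f) (pderiv 1 f) (pderiv 2 f) (pderiv 0 (pderiv 0 f))
    (-2 * pderiv 0 (pderiv 2 f)) (2 * pderiv 0 (pderiv 1 f) + pderiv 2 (pderiv 2 f))
    (-2 * pderiv 1 (pderiv 2 f))

/-- `remZero` applied to the first and second derivatives of `f`. -/
noncomputable def hessZero (f : MvPolynomial (Fin 3) K) : MvPolynomial (Fin 3) K :=
  remZero (pderiv 0 f) (pderiv 1 f) (pderiv 2 f) (pderiv 0 (pderiv 0 f))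
    (-2 * pderiv 0 (pderiv 2 f)) (2 * pderiv 0 (pderiv 1 f) + pderiv 2 (pderiv 2 f))
    (pderiv 1 (pderiv 1 f))

section Crossing

variable {v v' : K × K × K} {f : MvPolynomial (Fin 3) K}

theorem dirOne_dirOne (y : K) (f : MvPolynomial (Fin 3) K) :
    dirOne y (dirOne y f) = pderiv 0 (pderiv 0 f) * C y ^ 4 + (-2 * pderiv 0 (pderiv 2 f)) * C y ^ 3
      + (2 * pderiv 0 (pderiv 1 f) + pderiv 2 (pderiv 2 f)) * C y ^ 2 +
      (-2 * pderiv 1 (pderiv 2 f)) * C y + pderiv 1 (pderiv 1 f) := by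
  simp only [dirOne, map_sub, map_add, pderiv_mul, pderiv_pow, pderiv_C]
  rw [pderiv_comm 1 0 f, pderiv_comm 2 0 f, pderiv_comm 2 1 f]
  ring

theorem dirTwo_dirTwo (y : K) (f : MvPolynomial (Fin 3) K) :
    dirTwo y (dirTwo y f) = pderiv 0 (pderiv 0 f) + (-2 * pderiv 0 (pderiv 2 f)) * C y
      + (2 * pderiv 0 (pderiv 1 f) + pderiv 2 (pderiv 2 f)) * C y ^ 2 +
      (-2 * pderiv 1 (pderiv 2 f)) * C y ^ 3 + pderiv 1 (pderiv 1 f) * C y ^ 4 := by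
  simp only [dirTwo, map_sub, map_add, pderiv_mul, pderiv_pow, pderiv_C]
  rw [pderiv_comm 1 0 f, pderiv_comm 2 0 f, pderiv_comm 2 1 f]
  ring

variable (v v') in
/-- Evaluation at the crossing point. -/
noncomputable def crossEval : MvPolynomial (Fin 3) K →ₐ[K] K :=
  (Polynomial.aeval (crossParam v v')).comp (restrictOne v)

theorem crossEval_apply (F : MvPolynomial (Fin 3) K) :
    crossEval v v' F = (restrictOne v F).eval (crossParam v v') := rfl

theorem crossEval_eq (h : Crosses v v') (F : MvPolynomial (Fin 3) K) :
    crossEval v v' F = (restrictTwo v' F).eval (crossParam v' v) := eval_restrictOne_eq h F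

theorem crossEval_C (a : K) : crossEval v v' (C a) = a := by
  simp [crossEval]

theorem crossEval_dirOne (h1 : restrictOne v f = 0) : crossEval v v' (dirOne v.2.2 f) = 0 := by
  rw [crossEval_apply, ← derivative_restrictOne, h1]; simp

theorem crossEval_dirTwo (h : Crosses v v') (h2 : restrictTwo v' f = 0) :
    crossEval v v' (dirTwo v'.2.2 f) = 0 := by
  rw [crossEval_eq h, ← derivative_restrictTwo, h2]; simp

theorem crossEval_dirOne' (h1 : restrictOne v f = 0) :
    v.2.2 ^ 2 * crossEval v v' (pderiv 0 f) + crossEval v v' (pderiv 1 f) -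
      v.2.2 * crossEval v v' (pderiv 2 f) = 0 := by
  have := crossEval_dirOne (v' := v') h1
  simpa only [dirOne, map_sub, map_add, map_mul, map_pow, crossEval_C] using this

theorem crossEval_dirTwo' (h : Crosses v v') (h2 : restrictTwo v' f = 0) :
    crossEval v v' (pderiv 0 f) + v'.2.2 ^ 2 * crossEval v v' (pderiv 1 f) -
      v'.2.2 * crossEval v v' (pderiv 2 f) = 0 := by
  have := crossEval_dirTwo h h2
  simpa only [dirTwo, map_sub, map_add, map_mul, map_pow, crossEval_C] using this

theorem crossEval_hessOne (h : Crosses v v') (h1 : restrictOne v f = 0)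
    (h2 : restrictTwo v' f = 0) : crossEval v v' (hessOne f) = 0 := by
  have k1 := crossEval_dirOne (v' := v') (f := dirOne v.2.2 f)
    (by rw [← derivative_restrictOne, h1, Polynomial.derivative_zero])
  have k2 := crossEval_dirTwo h (f := dirTwo v'.2.2 f)
    (by rw [← derivative_restrictTwo, h2, Polynomial.derivative_zero])
  rw [dirOne_dirOne] at k1
  rw [dirTwo_dirTwo] at k2
  simp only [map_add, map_mul, map_pow, crossEval_C] at k1 k2
  have := remOne_eq_zero h.1 h.2.1 (crossEval_dirOne' h1) (crossEval_dirTwo' h h2) k1 k2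
  simpa only [hessOne, remOne, map_add, map_mul, map_pow, map_sub, map_neg, map_ofNat] using this

/-- At a crossing with `∂₀ f = 0`, all first derivatives of `f` vanish. -/
theorem crossEval_pderiv_eq_zero (h : Crosses v v') (h1 : restrictOne v f = 0)
    (h2 : restrictTwo v' f = 0) (h0 : crossEval v v' (pderiv 0 f) = 0) :
    crossEval v v' (pderiv 1 f) = 0 ∧ crossEval v v' (pderiv 2 f) = 0 := by
  have k1 := crossEval_dirOne' (v' := v') h1
  have k2 := crossEval_dirTwo' h h2
  rw [h0] at k1 k2
  have k3 : v'.2.2 * (v'.2.2 * crossEval v v' (pderiv 1 f) - crossEval v v' (pderiv 2 f)) = 0 := by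
    linear_combination k2
  have k4 := (mul_eq_zero.1 k3).resolve_left h.1
  have k5 : (1 - v.2.2 * v'.2.2) * crossEval v v' (pderiv 1 f) = 0 := by
    linear_combination k1 - v.2.2 * k4
  have k6 := (mul_eq_zero.1 k5).resolve_left h.2.1
  exact ⟨k6, by rw [k6] at k4; linear_combination -k4⟩

/-- The transversal derivative `2 y ∂₀ f - ∂₂ f`. -/
noncomputable def transOne (y : K) (f : MvPolynomial (Fin 3) K) : MvPolynomial (Fin 3) K :=
  2 * C y * pderiv 0 f - pderiv 2 f

theorem crossEval_transOne (h : Crosses v v') (h1 : restrictOne v f = 0)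
    (h2 : restrictTwo v' f = 0) :
    crossEval v v' (pderiv 0 f) +
      crossSlope v v' * crossEval v v' (transOne v.2.2 f) = 0 := by
  have k1 := crossEval_dirOne' (v' := v') h1
  have k2 := crossEval_dirTwo' h h2
  have hne := h.2.1
  simp only [transOne, map_sub, map_mul, crossEval_C, map_ofNat]
  have k3 : (1 - v.2.2 * v'.2.2) * crossSlope v v' = v'.2.2 := mul_div_cancel₀ _ hne
  have k4 : (1 - v.2.2 * v'.2.2) ^ 2 * (crossEval v v' (pderiv 0 f) + crossSlope v v' *
      (2 * v.2.2 * crossEval v v' (pderiv 0 f) - crossEval v v' (pderiv 2 f))) = 0 := by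
    linear_combination k2 - v'.2.2 ^ 2 * k1 + (1 - v.2.2 * v'.2.2) *
      (2 * v.2.2 * crossEval v v' (pderiv 0 f) - crossEval v v' (pderiv 2 f)) * k3
  exact (mul_eq_zero.1 k4).resolve_left (pow_ne_zero 2 hne)

end Crossing

end LocalAnalysis

section LocalAnalysis

open MvPolynomial

variable {K : Type*} [Field K]

theorem pderiv_dirOne (i : Fin 3) (y : K) (F : MvPolynomial (Fin 3) K) :
    pderiv i (dirOne y F) = dirOne y (pderiv i F) := by
  simp only [dirOne, map_sub, map_add, pderiv_mul, pderiv_pow, pderiv_C]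
  rw [pderiv_comm i 0 F, pderiv_comm i 1 F, pderiv_comm i 2 F]
  ring

theorem transOne_dirOne (y : K) (F : MvPolynomial (Fin 3) K) :
    transOne y (dirOne y F) = dirOne y (transOne y F) := by
  have h2 : ∀ i, pderiv i (2 : MvPolynomial (Fin 3) K) = 0 := fun i => by
    rw [← map_ofNat (C (σ := Fin 3) (R := K)) 2, pderiv_C]
  simp only [transOne, pderiv_dirOne]
  simp only [dirOne, map_sub, pderiv_mul, pderiv_C, h2]
  ring

/-- The quotient in the division of `a³ (h₄ θ⁴ + ⋯ + h₀)` by `a θ² - c θ + b`. -/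
noncomputable def hessQuot (y : K) (f : MvPolynomial (Fin 3) K) : MvPolynomial (Fin 3) K :=
  pderiv 0 f ^ 2 * pderiv 0 (pderiv 0 f) * C y ^ 2 +
    (pderiv 0 f ^ 2 * (-2 * pderiv 0 (pderiv 2 f)) +
      pderiv 0 f * pderiv 2 f * pderiv 0 (pderiv 0 f)) * C y +
    (pderiv 0 f ^ 2 * (2 * pderiv 0 (pderiv 1 f) + pderiv 2 (pderiv 2 f)) +
      pderiv 0 f * pderiv 2 f * (-2 * pderiv 0 (pderiv 2 f)) +
      (pderiv 2 f ^ 2 - pderiv 0 f * pderiv 1 f) * pderiv 0 (pderiv 0 f))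

theorem pderiv_pow_three_mul_dirOne (y : K) (f : MvPolynomial (Fin 3) K) :
    pderiv 0 f ^ 3 * dirOne y (dirOne y f) =
      hessQuot y f * dirOne y f + (hessOne f * C y + hessZero f) := by
  rw [dirOne_dirOne]
  simp only [hessQuot, hessOne, hessZero, remOne, remZero, dirOne]
  ring

theorem pderiv_pow_three_mul_transOne (y : K) (f : MvPolynomial (Fin 3) K) :
    pderiv 0 f ^ 3 * (2 * dirOne y (transOne y f)) =
      hessQuot y f * transOne y f + hessOne f +
      (2 * pderiv 0 f ^ 2 * pderiv 0 (pderiv 0 f) * C y +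
      (pderiv 0 f ^ 2 * (-2 * pderiv 0 (pderiv 2 f)) +
      pderiv 0 f * pderiv 2 f * pderiv 0 (pderiv 0 f))) * dirOne y f := by
  have h2 : ∀ i, pderiv i (2 : MvPolynomial (Fin 3) K) = 0 := fun i => by
    rw [← map_ofNat (C (σ := Fin 3) (R := K)) 2, pderiv_C]
  simp only [hessQuot, hessOne, remOne, dirOne, transOne, map_sub, pderiv_mul, pderiv_C, h2]
  rw [pderiv_comm 1 0 f, pderiv_comm 2 0 f]
  ring

theorem wronskian_ode {v : K × K × K} {f : MvPolynomial (Fin 3) K} (hf : restrictOne v f = 0)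
    (h1 : f ∣ hessOne f) (h0 : f ∣ hessZero f) (ha : restrictOne v (pderiv 0 f) ≠ 0)
    {a e : Polynomial K} (hadef : a = restrictOne v (pderiv 0 f))
    (hedef : e = restrictOne v (transOne v.2.2 f)) :
    e * (e * Polynomial.derivative (Polynomial.derivative a) -
        a * Polynomial.derivative (Polynomial.derivative e)) =
      2 * Polynomial.derivative e *
        (e * Polynomial.derivative a - a * Polynomial.derivative e) := by
  set y := v.2.2 with hy
  obtain ⟨k1, hk1⟩ := h1
  obtain ⟨k0, hk0⟩ := h0
  have hL1 : restrictOne v (dirOne y f) = 0 := by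
    rw [hy, ← derivative_restrictOne, hf, Polynomial.derivative_zero]
  have hL2 : restrictOne v (dirOne y (dirOne y f)) = 0 := by
    rw [hy, ← derivative_restrictOne, ← hy, hL1, Polynomial.derivative_zero]
  set Xd : Derivation K (MvPolynomial (Fin 3) K) (MvPolynomial (Fin 3) K) :=
    transOne y f • pderiv 0 - pderiv 0 f • ((2 * C y : MvPolynomial (Fin 3) K) •
      (pderiv 0 : Derivation K (MvPolynomial (Fin 3) K) (MvPolynomial (Fin 3) K)) - pderiv 2) with hXd
  have hX : ∀ F, Xd F = transOne y f * pderiv 0 F - pderiv 0 f * transOne y F := by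
    intro F
    simp [hXd, transOne]
  have hXf : Xd f = 0 := by rw [hX]; ring
  have e1 : restrictOne v (Xd (dirOne y f)) =
      e * Polynomial.derivative a - a * Polynomial.derivative e := by
    rw [hX, pderiv_dirOne, transOne_dirOne, map_sub, map_mul, map_mul, hadef, hedef,
      derivative_restrictOne, derivative_restrictOne]
  have e2 : restrictOne v (Xd (dirOne y (dirOne y f))) =
      e * Polynomial.derivative (Polynomial.derivative a) -
        a * Polynomial.derivative (Polynomial.derivative e) := by
    rw [hX, pderiv_dirOne, transOne_dirOne, pderiv_dirOne, transOne_dirOne, map_sub, map_mul,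
      map_mul, hadef, hedef]
    simp only [derivative_restrictOne, hy]
  have key := congrArg (fun F => restrictOne v (Xd F)) (pderiv_pow_three_mul_dirOne y f)
  rw [hk1, hk0, show f * k1 * C y + f * k0 = f * (k1 * C y + k0) by ring] at key
  simp only [Derivation.leibniz, map_add, smul_eq_mul, map_mul, hXf, hL1, hL2, hf,
    zero_mul, mul_zero, add_zero, e1, e2] at key
  have key2 := congrArg (restrictOne v) (pderiv_pow_three_mul_transOne y f)
  rw [hk1] at key2
  simp only [map_add, map_mul, hL1, hf, mul_zero, zero_mul, add_zero] at key2
  rw [← hedef, hy, ← derivative_restrictOne, ← hy, ← hedef, map_ofNat] at key2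
  have ha3 : restrictOne v (pderiv 0 f ^ 3) ≠ 0 := by rw [map_pow]; exact pow_ne_zero 3 ha
  apply mul_left_cancel₀ ha3
  linear_combination e * key - (e * Polynomial.derivative a - a * Polynomial.derivative e) * key2

theorem natDegree_lineOne_fst_le (v : K × K × K) : (lineOne v).1.natDegree ≤ 1 :=
  (Polynomial.natDegree_add_le _ _).trans (max_le (by rw [Polynomial.natDegree_C]; omega)
    ((Polynomial.natDegree_C_mul_le _ _).trans Polynomial.natDegree_X_le))

theorem natDegree_lineOne_snd_le (v : K × K × K) : (lineOne v).2.natDegree ≤ 1 :=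
  (Polynomial.natDegree_sub_le _ _).trans (max_le (by rw [Polynomial.natDegree_C]; omega)
    ((Polynomial.natDegree_C_mul_le _ _).trans Polynomial.natDegree_X_le))

theorem lineOne_injective : Function.Injective (lineOne : K × K × K → _) := by
  rintro ⟨b, x, y⟩ ⟨b', x', y'⟩ h
  simp only [lineOne, Prod.mk.injEq] at h
  have h1 := congrArg (Polynomial.coeff · 0) h.1
  have h2 := congrArg (Polynomial.coeff · 0) h.2
  have h3 := congrArg (Polynomial.coeff · 1) h.2
  simp at h1 h2 h3
  subst h2 h3
  simpa using h1

theorem natDegree_restrictOne_le (v : K × K × K) (F : MvPolynomial (Fin 3) K) :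
    (restrictOne v F).natDegree ≤ F.totalDegree := by
  have := aeval_natDegree_le (n := 1) F le_rfl ![(lineOne v).1, Polynomial.X, (lineOne v).2] (by
    intro i
    fin_cases i
    · exact natDegree_lineOne_fst_le v
    · exact Polynomial.natDegree_X_le
    · exact natDegree_lineOne_snd_le v)
  simpa [restrictOne, graphRestrict] using this

theorem natDegree_restrictTwo_le (v : K × K × K) (F : MvPolynomial (Fin 3) K) :
    (restrictTwo v F).natDegree ≤ F.totalDegree := by
  have := aeval_natDegree_le (n := 1) F le_rfl ![Polynomial.X, (lineOne v).1, (lineOne v).2] (by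
    intro i
    fin_cases i
    · exact Polynomial.natDegree_X_le
    · exact natDegree_lineOne_fst_le v
    · exact natDegree_lineOne_snd_le v)
  simpa [restrictTwo] using this

theorem totalDegree_transOne_le (y : K) (f : MvPolynomial (Fin 3) K) :
    (transOne y f).totalDegree ≤ f.totalDegree := by
  have h : ∀ i, (pderiv i f).totalDegree ≤ f.totalDegree := fun i =>
    (totalDegree_pderiv_le i f).trans (Nat.sub_le _ _)
  rw [transOne, ← map_ofNat (C (σ := Fin 3) (R := K)) 2, ← C_mul]
  refine (totalDegree_sub _ _).trans (max_le ?_ (h 2))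
  refine (totalDegree_mul _ _).trans ?_
  rw [totalDegree_C]
  simpa using h 0

theorem totalDegree_hessOne_le (f : MvPolynomial (Fin 3) K) :
    (hessOne f).totalDegree ≤ 4 * f.totalDegree := by
  set d := f.totalDegree
  have h : ∀ i, (pderiv i f).totalDegree ≤ d := fun i =>
    (totalDegree_pderiv_le i f).trans (Nat.sub_le _ _)
  have h' : ∀ i j, (pderiv i (pderiv j f)).totalDegree ≤ d := fun i j =>
    (totalDegree_pderiv_le i _).trans ((Nat.sub_le _ _).trans (h j))
  have hm : ∀ {F G : MvPolynomial (Fin 3) K} {m n k : ℕ}, F.totalDegree ≤ m → G.totalDegree ≤ n →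
      m + n ≤ k → (F * G).totalDegree ≤ k := fun h1 h2 h3 =>
    (totalDegree_mul _ _).trans ((add_le_add h1 h2).trans h3)
  have ha : ∀ {F G : MvPolynomial (Fin 3) K} {k : ℕ}, F.totalDegree ≤ k → G.totalDegree ≤ k →
      (F + G).totalDegree ≤ k := fun h1 h2 => (totalDegree_add _ _).trans (max_le h1 h2)
  have hs : ∀ {F G : MvPolynomial (Fin 3) K} {k : ℕ}, F.totalDegree ≤ k → G.totalDegree ≤ k →
      (F - G).totalDegree ≤ k := fun h1 h2 => (totalDegree_sub _ _).trans (max_le h1 h2)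
  have hc : (2 : MvPolynomial (Fin 3) K).totalDegree ≤ 0 := by
    rw [← map_ofNat (C (σ := Fin 3) (R := K)) 2, totalDegree_C]
  have hcn : (-2 : MvPolynomial (Fin 3) K).totalDegree ≤ 0 := by
    rw [totalDegree_neg]; exact hc
  have hp : ∀ (i : Fin 3) (n : ℕ), (pderiv i f ^ n).totalDegree ≤ n * d := fun i n =>
    (totalDegree_pow _ _).trans (Nat.mul_le_mul_left _ (h i))
  unfold hessOne remOne
  have e1 := hm hcn (h' 0 2) (zero_add d).le
  have e2 := ha (hm hc (h' 0 1) (zero_add d).le) (h' 2 2)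
  have e3 := hm hcn (h' 1 2) (zero_add d).le
  have e4 : (pderiv 2 f ^ 3 - 2 * pderiv 0 f * pderiv 1 f * pderiv 2 f).totalDegree ≤ 3 * d :=
    hs (hp 2 3) (hm (hm (hm hc (h 0) (zero_add d).le) (h 1) le_rfl) (h 2) (by omega))
  have e5 : (pderiv 0 f * (pderiv 2 f ^ 2 - pderiv 0 f * pderiv 1 f)).totalDegree ≤ 3 * d :=
    hm (h 0) (hs (hp 2 2) (hm (h 0) (h 1) (by omega))) (by omega)
  exact ha (ha (ha (hm (h' 0 0) e4 (by omega)) (hm e1 e5 (by omega)))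
    (hm e2 (hm (hp 0 2) (h 2) le_rfl) (by omega))) (hm e3 (hp 0 3) (by omega))

theorem totalDegree_hessZero_le (f : MvPolynomial (Fin 3) K) :
    (hessZero f).totalDegree ≤ 4 * f.totalDegree := by
  set d := f.totalDegree
  have h : ∀ i, (pderiv i f).totalDegree ≤ d := fun i =>
    (totalDegree_pderiv_le i f).trans (Nat.sub_le _ _)
  have h' : ∀ i j, (pderiv i (pderiv j f)).totalDegree ≤ d := fun i j =>
    (totalDegree_pderiv_le i _).trans ((Nat.sub_le _ _).trans (h j))
  have hm : ∀ {F G : MvPolynomial (Fin 3) K} {m n k : ℕ}, F.totalDegree ≤ m → G.totalDegree ≤ n →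
      m + n ≤ k → (F * G).totalDegree ≤ k := fun h1 h2 h3 =>
    (totalDegree_mul _ _).trans ((add_le_add h1 h2).trans h3)
  have ha : ∀ {F G : MvPolynomial (Fin 3) K} {k : ℕ}, F.totalDegree ≤ k → G.totalDegree ≤ k →
      (F + G).totalDegree ≤ k := fun h1 h2 => (totalDegree_add _ _).trans (max_le h1 h2)
  have hs : ∀ {F G : MvPolynomial (Fin 3) K} {k : ℕ}, F.totalDegree ≤ k → G.totalDegree ≤ k →
      (F - G).totalDegree ≤ k := fun h1 h2 => (totalDegree_sub _ _).trans (max_le h1 h2)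
  have hc : (2 : MvPolynomial (Fin 3) K).totalDegree ≤ 0 := by
    rw [← map_ofNat (C (σ := Fin 3) (R := K)) 2, totalDegree_C]
  have hcn : (-2 : MvPolynomial (Fin 3) K).totalDegree ≤ 0 := by
    rw [totalDegree_neg]; exact hc
  have hp : ∀ (i : Fin 3) (n : ℕ), (pderiv i f ^ n).totalDegree ≤ n * d := fun i n =>
    (totalDegree_pow _ _).trans (Nat.mul_le_mul_left _ (h i))
  unfold hessZero remZero
  have e1 := hm hcn (h' 0 2) (zero_add d).le
  have e2 := ha (hm hc (h' 0 1) (zero_add d).le) (h' 2 2)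
  have e4 : (pderiv 1 f * (pderiv 2 f ^ 2 - pderiv 0 f * pderiv 1 f)).totalDegree ≤ 3 * d :=
    hm (h 1) (hs (hp 2 2) (hm (h 0) (h 1) (by omega))) (by omega)
  exact hs (hs (hs (hm (h' 1 1) (hp 0 3) (by omega)) (hm (h' 0 0) e4 (by omega)))
    (hm e1 (hm (hm (h 0) (h 1) le_rfl) (h 2) le_rfl) (by omega)))
    (hm e2 (hm (hp 0 2) (h 1) le_rfl) (by omega))

/-- The polynomials which should not vanish on a generic line of the surface `f = 0`. -/
def IsGenericLine (v : K × K × K) (f F : MvPolynomial (Fin 3) K) : Prop :=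
  ∀ G ∈ [F, pderiv 0 f, pderiv 1 f, pderiv 2 f, hessOne f, hessZero f],
    ¬ f ∣ G → restrictOne v G ≠ 0

theorem exists_crossing_constraint {v : K × K × K} {f F : MvPolynomial (Fin 3) K} {d : ℕ}
    (hchar : ∀ m : ℕ, 0 < m → m ≤ 2 * d + 1 → (m : K) ≠ 0)
    (hprime : Prime f) (hd : f.totalDegree ≤ d) (hf : restrictOne v f = 0)
    (hgen : IsGenericLine v f F) :
    ∃ q : Polynomial K, q ≠ 0 ∧ q.natDegree ≤ 4 * d ∧ ∃ κ μ : K, ∀ v', Crosses v v' →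
      restrictTwo v' f = 0 → q.eval (crossParam v v') = 0 ∨
        crossSlope v v' = -(κ * crossParam v v' + μ) := by
  have hpd : ∀ i, (restrictOne v (pderiv i f)).natDegree ≤ d := fun i =>
    (natDegree_restrictOne_le _ _).trans ((totalDegree_pderiv_le i f).trans
      ((Nat.sub_le _ _).trans hd))
  have hpos : 0 < f.totalDegree := by
    by_contra! h
    have h0 := totalDegree_eq_zero_iff_eq_C.1 (Nat.le_zero.1 h)
    apply hprime.not_isUnit
    rw [h0] at hprime ⊢
    exact (IsUnit.mk0 _ fun h => hprime.ne_zero (by rw [h, C_0])).map C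
  have hndvd : ∀ i, pderiv i f ≠ 0 → ¬ f ∣ pderiv i f := by
    intro i hi hdvd
    have h1 := totalDegree_le_of_dvd_of_isDomain hdvd hi
    have h2 := totalDegree_pderiv_le i f
    omega
  have hmem : ∀ i, pderiv i f ∈
      [F, pderiv 0 f, pderiv 1 f, pderiv 2 f, hessOne f, hessZero f] := by
    intro i; fin_cases i <;> simp
  by_cases h0 : pderiv 0 f = 0
  · obtain ⟨i, hi⟩ : ∃ i, pderiv i f ≠ 0 := by
      by_contra! h
      have := totalDegree_eq_zero_of_pderiv hchar (by omega) h
      omega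
    refine ⟨restrictOne v (pderiv i f), hgen _ (hmem i) (hndvd i hi), (hpd i).trans (by omega),
      0, 0, fun v' hv' h2 => Or.inl ?_⟩
    have h3 := crossEval_pderiv_eq_zero hv' hf h2 (by rw [h0, map_zero])
    rw [← crossEval_apply]
    fin_cases i
    · exact (hi h0).elim
    · exact h3.1
    · exact h3.2
  have ha := hgen _ (hmem 0) (hndvd 0 h0)
  by_cases hr1 : f ∣ hessOne f
  swap
  · exact ⟨restrictOne v (hessOne f), hgen _ (by simp) hr1,
      (natDegree_restrictOne_le _ _).trans ((totalDegree_hessOne_le f).trans (by omega)), 0, 0,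
      fun v' hv' h2 => Or.inl (crossEval_hessOne hv' hf h2)⟩
  have hr0 : f ∣ hessZero f := by
    by_contra hcon
    refine hgen _ (by simp) hcon ?_
    have h1 := congrArg (restrictOne v) (pderiv_pow_three_mul_dirOne v.2.2 f)
    obtain ⟨k, hk⟩ := hr1
    have hL1 : restrictOne v (dirOne v.2.2 f) = 0 := by
      rw [← derivative_restrictOne, hf, Polynomial.derivative_zero]
    have hL2 : restrictOne v (dirOne v.2.2 (dirOne v.2.2 f)) = 0 := by
      rw [← derivative_restrictOne, hL1, Polynomial.derivative_zero]
    simpa only [map_add, map_mul, hk, hf, hL1, hL2, mul_zero, zero_mul, zero_add, eq_comm] using h1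
  refine ⟨restrictOne v (pderiv 0 f), ha, (hpd 0).trans (by omega), ?_⟩
  by_cases he : restrictOne v (transOne v.2.2 f) = 0
  · refine ⟨0, 0, fun v' hv' h2 => Or.inl ?_⟩
    have h3 := crossEval_transOne hv' hf h2
    rw [crossEval_apply, crossEval_apply, he] at h3
    simpa using h3
  · obtain ⟨κ, μ, h⟩ := Polynomial.exists_eq_linear_mul hchar (hpd 0)
      ((natDegree_restrictOne_le _ _).trans ((totalDegree_transOne_le _ f).trans hd)) he
      (wronskian_ode hf hr1 hr0 ha rfl rfl)
    refine ⟨κ, μ, fun v' hv' h2 => ?_⟩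
    have h3 := crossEval_transOne hv' hf h2
    rw [crossEval_apply, crossEval_apply, h, Polynomial.eval_mul] at h3
    simp only [Polynomial.eval_add, Polynomial.eval_mul, Polynomial.eval_C, Polynomial.eval_X] at h3
    have h4 : (κ * crossParam v v' + μ + crossSlope v v') *
        (restrictOne v (transOne v.2.2 f)).eval (crossParam v v') = 0 := by
      linear_combination h3
    rcases mul_eq_zero.1 h4 with h5 | h5
    · right; linear_combination h5
    · left
      rw [h, Polynomial.eval_mul, h5, mul_zero]

end LocalAnalysis

section GenericLine

open MvPolynomial Finset

variable {K : Type*} [Field K]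

theorem card_restrictOne_le {f g : MvPolynomial (Fin 3) K} (hf : Prime f) (hfg : ¬ f ∣ g)
    (V : Finset (K × K × K)) (hfV : ∀ v ∈ V, restrictOne v f = 0)
    (hgV : ∀ v ∈ V, restrictOne v g = 0) : #V ≤ 27 * f.totalDegree * g.totalDegree := by
  classical
  rw [← card_image_of_injective V lineOne_injective]
  refine card_graphs_le hf hfg _ ?_ ?_ ?_ ?_
  all_goals
    simp only [mem_image, forall_exists_index, and_imp, forall_apply_eq_imp_iff₂]
  · exact fun v _ => natDegree_lineOne_fst_le v
  · exact fun v _ => natDegree_lineOne_snd_le v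
  · exact hfV
  · exact hgV

theorem exists_isGenericLine {g F : MvPolynomial (Fin 3) K} {d : ℕ} (hg : Prime g)
    (hgd : g.totalDegree ≤ d) (hFd : F.totalDegree ≤ d) (V : Finset (K × K × K))
    (hV : ∀ v ∈ V, restrictOne v g = 0) (hcard : 324 * d * g.totalDegree < #V) :
    ∃ v ∈ V, IsGenericLine v g F := by
  classical
  by_contra! hbad
  set bad : MvPolynomial (Fin 3) K → Finset (K × K × K) := fun G =>
    {v ∈ V | ¬ g ∣ G ∧ restrictOne v G = 0} with hbaddef
  have hb : ∀ G, #(bad G) ≤ 27 * g.totalDegree * G.totalDegree := by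
    intro G
    by_cases hG : g ∣ G
    · have : bad G = ∅ := by simp [hbaddef, hG]
      simp [this]
    · exact card_restrictOne_le hg hG _ (fun v hv => hV v (mem_filter.1 hv).1)
        fun v hv => (mem_filter.1 hv).2.2
  have hsub : V ⊆ bad F ∪ (bad (pderiv 0 g) ∪ (bad (pderiv 1 g) ∪ (bad (pderiv 2 g) ∪
      (bad (hessOne g) ∪ bad (hessZero g))))) := by
    intro v hv
    have h := hbad v hv
    simp only [IsGenericLine, not_forall] at h
    obtain ⟨G, hG, hnd, h0⟩ := h
    have hvG : v ∈ bad G := mem_filter.2 ⟨hv, hnd, not_not.1 h0⟩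
    simp only [mem_union]
    simp only [List.mem_cons, List.not_mem_nil, or_false] at hG
    rcases hG with rfl | rfl | rfl | rfl | rfl | rfl <;> simp only [hvG, true_or, or_true]
  have hpd : ∀ i, (pderiv i g).totalDegree ≤ d := fun i =>
    (totalDegree_pderiv_le i g).trans ((Nat.sub_le _ _).trans hgd)
  have h1 := (totalDegree_hessOne_le g).trans (Nat.mul_le_mul_left 4 hgd)
  have h0 := (totalDegree_hessZero_le g).trans (Nat.mul_le_mul_left 4 hgd)
  have hb' : ∀ G m, G.totalDegree ≤ m → #(bad G) ≤ 27 * g.totalDegree * m := fun G m h =>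
    (hb G).trans (Nat.mul_le_mul_left _ h)
  have := (card_le_card hsub).trans <| (card_union_le _ _).trans <| add_le_add (hb' _ _ hFd) <|
    (card_union_le _ _).trans <| add_le_add (hb' _ _ (hpd 0)) <|
    (card_union_le _ _).trans <| add_le_add (hb' _ _ (hpd 1)) <|
    (card_union_le _ _).trans <| add_le_add (hb' _ _ (hpd 2)) <|
    (card_union_le _ _).trans <| add_le_add (hb' _ _ h1) (hb' _ _ h0)
  nlinarith

/-- If the surface `f = 0` contains many lines, then some prime factor `g` of `f` contains a line
which is generic with respect to `g` and the cofactor of `g` in `f`. -/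
theorem exists_prime_isGenericLine {f : MvPolynomial (Fin 3) K} (hf : f ≠ 0) {d : ℕ}
    (hd : f.totalDegree ≤ d) (V : Finset (K × K × K)) (hV : ∀ v ∈ V, restrictOne v f = 0)
    (hcard : 324 * d * d < #V) :
    ∃ v ∈ V, ∃ g F : MvPolynomial (Fin 3) K, ∃ e : ℕ, Prime g ∧ f = g ^ e * F ∧ ¬ g ∣ F ∧
      g.totalDegree ≤ d ∧ F.totalDegree ≤ d ∧ restrictOne v g = 0 ∧ IsGenericLine v g F := by
  classical
  have main : ∀ G : MvPolynomial (Fin 3) K, G ∣ f → ∀ V : Finset (K × K × K),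
      (∀ v ∈ V, restrictOne v G = 0) → 324 * d * G.totalDegree < #V →
      ∃ v ∈ V, ∃ g F : MvPolynomial (Fin 3) K, ∃ e : ℕ, Prime g ∧ f = g ^ e * F ∧ ¬ g ∣ F ∧
      g.totalDegree ≤ d ∧ F.totalDegree ≤ d ∧ restrictOne v g = 0 ∧ IsGenericLine v g F := by
    intro G
    induction G using UniqueFactorizationMonoid.induction_on_prime with
    | h₁ => exact fun h => (hf (zero_dvd_iff.1 h)).elim
    | h₂ G hG =>
      intro _ V hV hc
      obtain ⟨v, hv⟩ := card_pos.1 (Nat.zero_lt_of_lt hc)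
      have := hG.map (restrictOne v)
      rw [hV v hv] at this
      exact (not_isUnit_zero this).elim
    | h₃ G g hG hg ih =>
      intro hdvd V hV hc
      have hgf : g ∣ f := (dvd_mul_right g G).trans hdvd
      obtain ⟨F, hF, hgF⟩ := (FiniteMultiplicity.of_prime_left hg hf).exists_eq_pow_mul_and_not_dvd
      have hgd : g.totalDegree ≤ d := (totalDegree_le_of_dvd_of_isDomain hgf hf).trans hd
      have hFd : F.totalDegree ≤ d :=
        (totalDegree_le_of_dvd_of_isDomain (hF ▸ dvd_mul_left _ _) hf).trans hd
      set Vg := V.filter fun v => restrictOne v g = 0 with hVg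
      rcases lt_or_ge (324 * d * g.totalDegree) #Vg with h | h
      · obtain ⟨v, hv, hgen⟩ := exists_isGenericLine hg hgd hFd Vg
          (fun v hv => (mem_filter.1 hv).2) h
        exact ⟨v, (mem_filter.1 hv).1, g, F, _, hg, hF, hgF, hgd, hFd, (mem_filter.1 hv).2, hgen⟩
      · rw [totalDegree_mul_of_isDomain hg.ne_zero hG, mul_add] at hc
        have hsplit := card_filter_add_card_filter_not (s := V) fun v => restrictOne v g = 0
        rw [← hVg] at hsplit
        obtain ⟨v, hv, h⟩ := ih ((dvd_mul_left G g).trans hdvd)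
          (V.filter fun v => ¬ restrictOne v g = 0) (fun v hv => by
            have h1 := hV v (mem_filter.1 hv).1
            rw [map_mul] at h1
            exact (mul_eq_zero.1 h1).resolve_left (mem_filter.1 hv).2) (by omega)
        exact ⟨v, (mem_filter.1 hv).1, h⟩
  exact main f dvd_rfl V hV (lt_of_le_of_lt (Nat.mul_le_mul_left _ hd) hcard)

end GenericLine

section LowDegree

open MvPolynomial Finset

variable {K : Type*} [Field K]

theorem card_le_natDegree_of_eval_eq_zero {ι : Type*} {q : Polynomial K} (hq : q ≠ 0)
    (A : Finset ι) (φ : ι → K) (hφ : ∀ a ∈ A, ∀ b ∈ A, φ a = φ b → a = b)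
    (h : ∀ a ∈ A, q.eval (φ a) = 0) : #A ≤ q.natDegree := by
  classical
  rw [← card_image_of_injOn (s := A) (f := φ) fun a ha b hb hab => hφ a ha b hb hab]
  refine Polynomial.card_le_degree_of_subset_roots fun x hx => ?_
  obtain ⟨a, ha, rfl⟩ := mem_image.1 hx
  exact (Polynomial.mem_roots hq).2 (h a ha)

theorem totalDegree_le_of_mem_restrictDegree {f : MvPolynomial (Fin 3) K} {D : ℕ}
    (hf : f ∈ restrictDegree (Fin 3) K D) : f.totalDegree ≤ 3 * D := by
  refine Finset.sup_le fun s hs => ?_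
  have h := (mem_restrictDegree _ _ _).1 hf s hs
  have h0 := h 0
  have h1 := h 1
  have h2 := h 2
  rw [Finsupp.sum_fintype _ _ (by simp), Fin.sum_univ_three]
  omega

/-- A nonzero polynomial of low degree vanishing on a small set of lines. -/
theorem exists_restrictTwo_eq_zero (S : Finset (K × K × K)) {D : ℕ}
    (h : #S * (3 * D + 1) < (D + 1) ^ 3) :
    ∃ f : MvPolynomial (Fin 3) K, f ≠ 0 ∧ f.totalDegree ≤ 3 * D ∧
      ∀ v ∈ S, restrictTwo v f = 0 := by
  let φ : restrictDegree (Fin 3) K D →ₗ[K] (S → Fin (3 * D + 1) → K) :=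
    LinearMap.pi fun v => LinearMap.pi fun i =>
      (Polynomial.lcoeff K i) ∘ₗ (restrictTwo v.1).toLinearMap ∘ₗ (Submodule.subtype _)
  have hfin : Module.finrank K (restrictDegree (Fin 3) K D) = (D + 1) ^ 3 := by
    rw [finrank_restrictDegree]; simp
  have : Module.Finite K (restrictDegree (Fin 3) K D) :=
    Module.finite_of_finrank_pos (by rw [hfin]; positivity)
  have hker : LinearMap.ker φ ≠ ⊥ := by
    apply LinearMap.ker_ne_bot_of_finrank_lt
    rw [hfin]
    simpa [Module.finrank_pi_fintype] using h
  obtain ⟨f, hf, hf0⟩ := Submodule.exists_mem_ne_zero_of_ne_bot hker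
  have hdeg := totalDegree_le_of_mem_restrictDegree f.2
  refine ⟨f.1, fun h => hf0 (Subtype.ext h), hdeg, fun v hv => ?_⟩
  ext i
  rw [Polynomial.coeff_zero]
  by_cases hi : i < 3 * D + 1
  · exact congrFun (congrFun (LinearMap.mem_ker.1 hf) ⟨v, hv⟩) ⟨i, hi⟩
  · apply Polynomial.coeff_eq_zero_of_natDegree_lt
    have := natDegree_restrictTwo_le v f.1
    omega

theorem mul_one_sub_pow_lt {N T k D : ℕ} (hN : N < 2 ^ D) (hTN : 0 < N)
    (hk : 16 * D * N ≤ k * T) (hle : T ≤ N) :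
    (N : ℝ) * (1 - (T : ℝ) / (4 * N)) ^ k < (1 / 2 : ℝ) ^ (3 * D) := by
  have hN0 : (0 : ℝ) < N := by exact_mod_cast hTN
  have hle' : (T : ℝ) ≤ N := by exact_mod_cast hle
  have hρ : (T : ℝ) / (4 * N) ≤ 1 := by
    rw [div_le_one (by positivity)]; linarith
  have h1 : (1 - (T : ℝ) / (4 * N)) ^ k ≤ Real.exp (-(4 * D : ℕ)) := by
    calc (1 - (T : ℝ) / (4 * N)) ^ k ≤ Real.exp (-(T / (4 * N))) ^ k :=
          pow_le_pow_left₀ (by linarith) (Real.one_sub_le_exp_neg _) k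
      _ = Real.exp (k * -(T / (4 * N))) := by rw [← Real.exp_nat_mul]
      _ ≤ _ := by
        apply Real.exp_le_exp.2
        have hk' : (16 * D * N : ℝ) ≤ k * T := by exact_mod_cast hk
        have : (4 * D : ℝ) ≤ k * (T / (4 * N)) := by
          rw [← mul_div_assoc, le_div_iff₀ (by positivity)]
          linarith
        push_cast
        linarith
  have h2 : Real.exp (-(4 * D : ℕ)) ≤ (1 / 2 : ℝ) ^ (4 * D) := by
    rw [Real.exp_neg, ← Real.exp_one_pow, one_div, inv_pow]
    have : (2 : ℝ) ≤ Real.exp 1 := by linarith [Real.add_one_le_exp (1 : ℝ)]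
    gcongr
  have hN' : (N : ℝ) < 2 ^ D := by exact_mod_cast hN
  calc (N : ℝ) * (1 - (T : ℝ) / (4 * N)) ^ k ≤ N * (1 / 2 : ℝ) ^ (4 * D) :=
        mul_le_mul_of_nonneg_left (h1.trans h2) hN0.le
    _ < 2 ^ D * (1 / 2 : ℝ) ^ (4 * D) := by gcongr
    _ = _ := by
      rw [show 4 * D = D + 3 * D by ring, pow_add, ← mul_assoc, ← mul_pow]
      norm_num

/-- A large family of pairs of lines in `K³` with a crossing relation has a vertex of low degree. -/
theorem exists_low_degree [DecidableEq K] (V : Finset (K × K × K)) (R : K × K × K → K × K × K → Prop)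
    [∀ v, DecidablePred (R v)]
    (hsymm : ∀ v v', R v v' → R v' v) (hcross : ∀ v v', R v v' → Crosses v v')
    (hinj : ∀ v v₁ v₂, R v v₁ → R v v₂ → crossParam v v₁ = crossParam v v₂ → v₁ = v₂)
    {M D T k : ℕ}
    (hslope : ∀ v ∈ V, ∀ κ μ : K,
      #{v' ∈ V | R v v' ∧ crossSlope v v' = -(κ * crossParam v v' + μ)} ≤ M)
    (hchar : ∀ m : ℕ, 0 < m → m ≤ 6 * D + 1 → (m : K) ≠ 0)
    (hV : 2916 * D ^ 2 < #V) (hVD : #V < 2 ^ D) (hTD : 6 * D ≤ T) (hT0 : 0 < T)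
    (hk : 16 * D * #V ≤ k * T) (hkD : 3 * k < (D + 1) ^ 2) (hTM : 15 * D + M < T) :
    ∃ v ∈ V, #{v' ∈ V | R v v'} < T := by
  classical
  by_contra! hT
  have hV0 : 0 < #V := by omega
  obtain ⟨v₀, hv₀⟩ := card_pos.1 hV0
  have hTV : T ≤ #V := (hT v₀ hv₀).trans (card_filter_le _ _)
  have hTV' : (T : ℝ) ≤ #V := by exact_mod_cast hTV
  have hV0' : (0 : ℝ) < #V := by exact_mod_cast hV0
  obtain ⟨S, hSV, hSk, hS⟩ := exists_small_cover V V R T (3 * D) k ((T : ℝ) / (4 * #V)) hT0 hT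
    (by omega) (by positivity) (by rw [div_le_one (by positivity)]; linarith)
    (by rw [div_mul_cancel₀ _ (by positivity)]) (mul_one_sub_pow_lt hVD hV0 hk hTV)
  obtain ⟨f, hf0, hfd, hfS⟩ := exists_restrictTwo_eq_zero S (D := D) (by
    calc #S * (3 * D + 1) ≤ k * (3 * (D + 1)) := Nat.mul_le_mul hSk (by omega)
      _ = (3 * k) * (D + 1) := by ring
      _ < (D + 1) ^ 2 * (D + 1) := Nat.mul_lt_mul_of_pos_right hkD (by omega)
      _ = _ := by ring)
  have hone : ∀ v ∈ V, restrictOne v f = 0 := by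
    intro v hv
    by_contra hne
    have h1 := card_le_natDegree_of_eval_eq_zero hne {v' ∈ S | R v v'} (crossParam v)
      (fun a ha b hb => hinj v a b (mem_filter.1 ha).2 (mem_filter.1 hb).2) (fun a ha => by
        rw [eval_restrictOne_eq (hcross _ _ (mem_filter.1 ha).2), hfS a (mem_filter.1 ha).1,
          Polynomial.eval_zero])
    have h2 := natDegree_restrictOne_le v f
    have h3 := hS v hv
    omega
  have htwo : ∀ v ∈ V, restrictTwo v f = 0 := by
    intro v hv
    by_contra hne
    have h1 := card_le_natDegree_of_eval_eq_zero hne {v' ∈ V | R v v'} (crossParam v)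
      (fun a ha b hb => hinj v a b (mem_filter.1 ha).2 (mem_filter.1 hb).2) (fun a ha => by
        rw [← eval_restrictOne_eq (hcross _ _ (hsymm _ _ (mem_filter.1 ha).2)),
          hone a (mem_filter.1 ha).1, Polynomial.eval_zero])
    have h2 := natDegree_restrictTwo_le v f
    have h3 := hT v hv
    omega
  obtain ⟨v, hv, g, F, e, hg, hfac, hgF, hgd, hFd, hvg, hgen⟩ :=
    exists_prime_isGenericLine hf0 hfd V hone (by nlinarith)
  obtain ⟨q, hq0, hqd, κ, μ, hq⟩ := exists_crossing_constraint
    (fun m h1 h2 => hchar m h1 (by omega)) hg hgd hvg hgen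
  have hF0 : restrictOne v F ≠ 0 := hgen F (by simp) hgF
  have hsub : {v' ∈ V | R v v'} ⊆ {v' ∈ V | R v v' ∧ (restrictOne v F).eval (crossParam v v') = 0} ∪
      ({v' ∈ V | R v v' ∧ q.eval (crossParam v v') = 0} ∪
        {v' ∈ V | R v v' ∧ crossSlope v v' = -(κ * crossParam v v' + μ)}) := by
    intro v' hv'
    obtain ⟨hv'V, hR⟩ := mem_filter.1 hv'
    have h := htwo v' hv'V
    rw [hfac, map_mul, map_pow] at h
    simp only [mem_union, mem_filter, hv'V, hR, true_and]
    rcases mul_eq_zero.1 h with h | h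
    · exact Or.inr (hq v' (hcross _ _ hR) (eq_zero_of_pow_eq_zero h))
    · left
      rw [eval_restrictOne_eq (hcross _ _ hR), h, Polynomial.eval_zero]
  have h1 := card_le_natDegree_of_eval_eq_zero hF0
    {v' ∈ V | R v v' ∧ (restrictOne v F).eval (crossParam v v') = 0} (crossParam v)
    (fun a ha b hb => hinj v a b (mem_filter.1 ha).2.1 (mem_filter.1 hb).2.1)
    (fun a ha => (mem_filter.1 ha).2.2)
  have h2 := card_le_natDegree_of_eval_eq_zero hq0
    {v' ∈ V | R v v' ∧ q.eval (crossParam v v') = 0} (crossParam v)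
    (fun a ha b hb => hinj v a b (mem_filter.1 ha).2.1 (mem_filter.1 hb).2.1)
    (fun a ha => (mem_filter.1 ha).2.2)
  have h3 := (natDegree_restrictOne_le v F).trans hFd
  have h4 := hslope v hv κ μ
  have h5 := (card_le_card hsub).trans <| (card_union_le _ _).trans <|
    add_le_add le_rfl (card_union_le _ _)
  have h6 := hT v hv
  omega

end LowDegree

section Specialization

open Polynomial Finset

variable {F : Type*} [Field F]

/-- Perturbation of a triple over `F` to a triple over `F(t)`. -/
noncomputable def perturb (v : F × F × F) :
    FractionRing F[X] × FractionRing F[X] × FractionRing F[X] :=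
  (algebraMap F[X] _ (C v.1), algebraMap F[X] _ (X * (C v.2.1 + X)),
    algebraMap F[X] _ (X * C v.2.2))

theorem algebraMap_fractionRing_inj {p q : F[X]} :
    algebraMap F[X] (FractionRing F[X]) p = algebraMap F[X] (FractionRing F[X]) q ↔ p = q :=
  (IsFractionRing.injective F[X] (FractionRing F[X])).eq_iff

theorem perturb_injective : Function.Injective (perturb : F × F × F → _) := by
  rintro ⟨b, x, y⟩ ⟨b', x', y'⟩ h
  simp only [perturb, Prod.mk.injEq, algebraMap_fractionRing_inj] at h
  obtain ⟨h1, h2, h3⟩ := h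
  have h2' := mul_left_cancel₀ X_ne_zero h2
  have h3' := mul_left_cancel₀ X_ne_zero h3
  rw [C_inj.1 h1, C_inj.1 (add_right_cancel h2'), C_inj.1 h3']

theorem one_sub_perturb_ne_zero (y y' : F) : (1 - (X * C y) * (X * C y') : F[X]) ≠ 0 := by
  intro h
  simpa using congrArg (eval 0) h

theorem algebraMap_one_sub_perturb_ne_zero (y y' : F) :
    1 - algebraMap F[X] (FractionRing F[X]) (X * C y) *
      algebraMap F[X] (FractionRing F[X]) (X * C y') ≠ 0 := by
  intro h
  apply one_sub_perturb_ne_zero y y'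
  rw [← algebraMap_fractionRing_inj, map_sub, map_one, map_mul, map_zero, h]

theorem crosses_perturb {v v' : F × F × F} (h0 : v'.2.2 ≠ 0)
    (h : v.2.1 - v.2.2 * v'.1 = v'.2.1 - v'.2.2 * v.1) : Crosses (perturb v) (perturb v') := by
  refine ⟨?_, algebraMap_one_sub_perturb_ne_zero _ _, ?_⟩
  · rw [perturb, ← map_zero (algebraMap F[X] _), Ne, algebraMap_fractionRing_inj]
    exact mul_ne_zero X_ne_zero (C_ne_zero.2 h0)
  · simp only [perturb]
    rw [← map_mul, ← map_sub, ← map_mul, ← map_sub, algebraMap_fractionRing_inj]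
    have h' := congrArg (C : F → F[X]) h
    simp only [C_sub, C_mul] at h'
    linear_combination X * h'

theorem crossSlope_perturb_mul (v v' : F × F × F) :
    crossSlope (perturb v) (perturb v') * algebraMap F[X] _ (1 - (X * C v.2.2) * (X * C v'.2.2)) =
      algebraMap F[X] _ (X * C v'.2.2) := by
  rw [map_sub, map_one, map_mul]
  exact div_mul_cancel₀ _ (algebraMap_one_sub_perturb_ne_zero _ _)

theorem eq_of_crossSlope_perturb {v v₁ v₂ : F × F × F}
    (h : crossSlope (perturb v) (perturb v₁) = crossSlope (perturb v) (perturb v₂)) :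
    v₁.2.2 = v₂.2.2 := by
  have h1 := crossSlope_perturb_mul v v₁
  have h2 := crossSlope_perturb_mul v v₂
  have h3 : algebraMap F[X] (FractionRing F[X])
        (X * (C v₁.2.2 * (1 - (X * C v.2.2) * (X * C v₂.2.2)))) =
      algebraMap F[X] _ (X * (C v₂.2.2 * (1 - (X * C v.2.2) * (X * C v₁.2.2)))) := by
    rw [← mul_assoc X, ← mul_assoc X, RingHom.map_mul _ (X * C v₁.2.2),
      RingHom.map_mul _ (X * C v₂.2.2), ← h1, ← h2, h]
    ring
  rw [algebraMap_fractionRing_inj] at h3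
  simpa using congrArg (eval 0) (mul_left_cancel₀ X_ne_zero h3)

theorem algebraMap_C_add_X_ne_zero (w : F) :
    algebraMap F[X] (FractionRing F[X]) (C w + X) ≠ 0 := by
  rw [← map_zero (algebraMap F[X] _), Ne, algebraMap_fractionRing_inj, add_comm]
  exact X_add_C_ne_zero w

theorem algebraMap_X_ne_zero : algebraMap F[X] (FractionRing F[X]) X ≠ 0 := by
  rw [← map_zero (algebraMap F[X] _), Ne, algebraMap_fractionRing_inj]
  exact X_ne_zero

theorem crossParam_perturb (v v' : F × F × F) :
    crossParam (perturb v) (perturb v') = algebraMap F[X] _ (C v'.1) -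
      crossSlope (perturb v) (perturb v') * (algebraMap F[X] _ X *
        algebraMap F[X] _ (C (v.2.1 - v.2.2 * v'.1) + X)) := by
  simp only [crossParam, perturb, map_sub, map_mul, map_add]
  ring

theorem crossParam_perturb_mul (v v' : F × F × F) :
    crossParam (perturb v) (perturb v') *
      algebraMap F[X] _ (1 - (X * C v.2.2) * (X * C v'.2.2)) =
    algebraMap F[X] _ (C v'.1 * (1 - (X * C v.2.2) * (X * C v'.2.2)) -
      (X * C v'.2.2) * (X * (C (v.2.1 - v.2.2 * v'.1) + X))) := by
  have h := crossSlope_perturb_mul v v'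
  rw [crossParam_perturb, RingHom.map_sub _ (_ * _), RingHom.map_mul _ (C v'.1), RingHom.map_mul _ (X * C v'.2.2),
    RingHom.map_mul _ X (_ + _), ← h]
  ring

theorem eq_fst_of_crossParam_perturb {v v₁ v₂ : F × F × F}
    (h : crossParam (perturb v) (perturb v₁) = crossParam (perturb v) (perturb v₂)) :
    v₁.1 = v₂.1 := by
  have h1 := crossParam_perturb_mul v v₁
  have h2 := crossParam_perturb_mul v v₂
  rw [h] at h1
  have h3 := congrArg
    (· * algebraMap F[X] (FractionRing F[X]) (1 - (X * C v.2.2) * (X * C v₂.2.2))) h1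
  beta_reduce at h3
  rw [mul_right_comm, h2, ← map_mul, ← map_mul, algebraMap_fractionRing_inj] at h3
  simpa [eq_comm] using congrArg (eval 0) h3

theorem eq_of_crossParam_perturb {v v₁ v₂ : F × F × F}
    (h₁ : v.2.1 - v.2.2 * v₁.1 = v₁.2.1 - v₁.2.2 * v.1)
    (h₂ : v.2.1 - v.2.2 * v₂.1 = v₂.2.1 - v₂.2.2 * v.1)
    (h : crossParam (perturb v) (perturb v₁) = crossParam (perturb v) (perturb v₂)) :
    v₁ = v₂ := by
  have hb := eq_fst_of_crossParam_perturb h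
  rw [crossParam_perturb, crossParam_perturb, hb, sub_right_inj] at h
  have hy := eq_of_crossSlope_perturb (mul_right_cancel₀
    (mul_ne_zero algebraMap_X_ne_zero (algebraMap_C_add_X_ne_zero _)) h)
  refine Prod.ext hb (Prod.ext ?_ hy)
  rw [hb, hy] at h₁
  linear_combination h₂ - h₁

/-- The relation between `(b, λ)` and `(b', λ')` expressing that the incidences `(b', λ)` and
`(b, λ')` of `I` have the same ordinate. -/
def IncRel (I : Finset (F × F × F)) (v v' : F × F × F) : Prop :=
  (v'.1, v.2) ∈ I ∧ (v.1, v'.2) ∈ I ∧ v.2.1 - v.2.2 * v'.1 = v'.2.1 - v'.2.2 * v.1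

instance [DecidableEq F] (I : Finset (F × F × F)) (v : F × F × F) : DecidablePred (IncRel I v) :=
  fun _ => inferInstanceAs (Decidable (_ ∧ _))

theorem card_crossSlope_perturb_le [DecidableEq F] {I V : Finset (F × F × F)} {B : Finset F}
    (hVB : ∀ v ∈ V, v.1 ∈ B) {k : ℕ}
    (hI : ∀ b w, #{i ∈ I | i.1 = b ∧ i.2.1 - i.2.2 * b = w} ≤ k) {v : F × F × F}
    (hv : v.2.2 ≠ 0) (κ μ : FractionRing F[X]) (A : Finset (F × F × F)) (hAV : A ⊆ V)
    (hA : ∀ v' ∈ A, IncRel I v v' ∧ crossSlope (perturb v) (perturb v') =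
      -(κ * crossParam (perturb v) (perturb v') + μ)) : #A ≤ #B + k := by
  classical
  have hexc : ∃ b₀, ∀ b, κ * (algebraMap F[X] _ X *
      algebraMap F[X] _ (C (v.2.1 - v.2.2 * b) + X)) = 1 → b = b₀ := by
    by_cases h : ∃ b₀, κ * (algebraMap F[X] _ X *
      algebraMap F[X] _ (C (v.2.1 - v.2.2 * b₀) + X)) = 1
    · obtain ⟨b₀, h₀⟩ := h
      refine ⟨b₀, fun b hb => ?_⟩
      have hκ : κ ≠ 0 := by rintro rfl; simp at hb
      have h1 := mul_left_cancel₀ algebraMap_X_ne_zero (mul_left_cancel₀ hκ (hb.trans h₀.symm))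
      rw [algebraMap_fractionRing_inj] at h1
      have h2 := C_inj.1 (add_right_cancel h1)
      exact mul_left_cancel₀ hv (sub_right_inj.1 h2)
    · exact ⟨0, fun b hb => (h ⟨b, hb⟩).elim⟩
  obtain ⟨b₀, hb₀⟩ := hexc
  rw [← card_filter_add_card_filter_not (s := A) fun v' => v'.1 ≠ b₀]
  refine add_le_add ?_ ?_
  · refine card_le_card_of_injOn Prod.fst (fun v' hv' => hVB _ (hAV (mem_filter.1 hv').1)) ?_
    intro v₁ h₁ v₂ h₂ h
    obtain ⟨h₁A, h₁b⟩ := mem_filter.1 h₁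
    obtain ⟨h₂A, h₂b⟩ := mem_filter.1 h₂
    obtain ⟨⟨-, -, r₁⟩, s₁⟩ := hA v₁ h₁A
    obtain ⟨⟨-, -, r₂⟩, s₂⟩ := hA v₂ h₂A
    have hne : 1 - κ * (algebraMap F[X] _ X *
      algebraMap F[X] _ (C (v.2.1 - v.2.2 * v₁.1) + X)) ≠ 0 := fun h =>
      h₁b (hb₀ _ (sub_eq_zero.1 h).symm)
    have hy : v₁.2.2 = v₂.2.2 := by
      apply eq_of_crossSlope_perturb (v := v)
      apply mul_right_cancel₀ hne
      rw [crossParam_perturb] at s₁ s₂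
      rw [← h] at s₂
      linear_combination s₁ - s₂
    refine Prod.ext h (Prod.ext ?_ hy)
    rw [h, hy] at r₁
    linear_combination r₂ - r₁
  · refine le_trans ?_ (hI v.1 (v.2.1 - v.2.2 * b₀))
    refine card_le_card_of_injOn (fun v' => (v.1, v'.2)) ?_ ?_
    · intro v' hv'
      obtain ⟨h1, h2⟩ := mem_filter.1 hv'
      obtain ⟨⟨-, r1, r2⟩, -⟩ := hA v' h1
      rw [not_not.1 h2] at r2
      exact mem_filter.2 ⟨r1, rfl, r2.symm⟩
    · intro v₁ h₁ v₂ h₂ h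
      have e1 := not_not.1 (mem_filter.1 h₁).2
      have e2 := not_not.1 (mem_filter.1 h₂).2
      exact Prod.ext (e1.trans e2.symm) (Prod.mk.inj h).2

theorem exists_low_degree_incRel [DecidableEq F] (I V : Finset (F × F × F)) (B : Finset F)
    (hVB : ∀ v ∈ V, v.1 ∈ B) (hy : ∀ v ∈ V, v.2.2 ≠ 0) {k₂ : ℕ}
    (hI : ∀ b w, #{i ∈ I | i.1 = b ∧ i.2.1 - i.2.2 * b = w} ≤ k₂) {D T k : ℕ}
    (hchar : ∀ m : ℕ, 0 < m → m ≤ 6 * D + 1 → (m : F) ≠ 0)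
    (hV : 2916 * D ^ 2 < #V) (hVD : #V < 2 ^ D) (hTD : 6 * D ≤ T) (hT0 : 0 < T)
    (hk : 16 * D * #V ≤ k * T) (hkD : 3 * k < (D + 1) ^ 2) (hTM : 15 * D + (#B + k₂) < T) :
    ∃ v ∈ V, #{v' ∈ V | IncRel I v v'} < T := by
  classical
  let R : FractionRing F[X] × FractionRing F[X] × FractionRing F[X] →
      FractionRing F[X] × FractionRing F[X] × FractionRing F[X] → Prop := fun u u' =>
    ∃ v ∈ V, ∃ v' ∈ V, perturb v = u ∧ perturb v' = u' ∧ IncRel I v v'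
  have hR : ∀ v ∈ V, ∀ v' ∈ V, (R (perturb v) (perturb v') ↔ IncRel I v v') := by
    refine fun v hv v' hv' => ⟨?_, fun h => ⟨v, hv, v', hv', rfl, rfl, h⟩⟩
    rintro ⟨u, -, u', -, h1, h2, h⟩
    rwa [perturb_injective h1, perturb_injective h2] at h
  have hcard : #(V.image perturb) = #V := card_image_of_injective _ perturb_injective
  obtain ⟨u, hu, hlt⟩ := exists_low_degree (V.image perturb) R
    (by
      rintro _ _ ⟨v, hv, v', hv', rfl, rfl, h1, h2, h3⟩
      exact ⟨v', hv', v, hv, rfl, rfl, h2, h1, h3.symm⟩)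
    (by
      rintro _ _ ⟨v, hv, v', hv', rfl, rfl, h1, h2, h3⟩
      exact crosses_perturb (hy v' hv') h3)
    (by
      rintro _ _ _ ⟨v, hv, v₁, hv₁, rfl, rfl, h1⟩ ⟨v', hv', v₂, hv₂, he, rfl, h2⟩ h
      rw [perturb_injective he] at h2
      rw [eq_of_crossParam_perturb h1.2.2 h2.2.2 h])
    (M := #B + k₂) (D := D) (T := T) (k := k)
    (by
      intro u hu κ μ
      obtain ⟨v, hv, rfl⟩ := mem_image.1 hu
      rw [filter_image, card_image_of_injective _ perturb_injective]
      refine card_crossSlope_perturb_le hVB hI (hy v hv) κ μ _ (filter_subset _ _) ?_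
      intro v' hv'
      obtain ⟨h1, h2, h3⟩ := mem_filter.1 hv'
      exact ⟨(hR v hv v' h1).1 h2, h3⟩)
    (by
      intro m h1 h2 h
      apply hchar m h1 h2
      rw [← map_natCast (algebraMap F[X] (FractionRing F[X])), ← map_zero (algebraMap F[X] _),
        algebraMap_fractionRing_inj, ← map_natCast C, C_eq_zero] at h
      exact h)
    (by rwa [hcard]) (by rwa [hcard]) hTD hT0 (by rwa [hcard]) hkD hTM
  obtain ⟨v, hv, rfl⟩ := mem_image.1 hu
  refine ⟨v, hv, ?_⟩
  rw [filter_image, card_image_of_injective _ perturb_injective] at hlt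
  rwa [filter_congr fun v' hv' => hR v hv v' hv'] at hlt

end Specialization

section Energy

open Finset

theorem sum_card_related_le {α : Type*} [DecidableEq α] (R : α → α → Prop)
    [∀ a, DecidablePred (R a)] (hsymm : ∀ a b, R a b → R b a) {t : ℕ} (V : Finset α)
    (h : ∀ U ⊆ V, U.Nonempty → ∃ a ∈ U, #{b ∈ U | R a b} ≤ t) :
    ∑ a ∈ V, #{b ∈ V | R a b} ≤ 2 * #V * t := by
  induction hn : #V generalizing V with
  | zero => simp [card_eq_zero.1 hn]
  | succ n ih =>
    obtain ⟨a, ha, hat⟩ := h V subset_rfl (card_pos.1 (by omega))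
    have hcard : #(V.erase a) = n := by rw [card_erase_of_mem ha]; omega
    have h1 := ih (V.erase a) (fun U hU => h U (hU.trans (erase_subset _ _))) hcard
    have h2 : ∀ b ∈ V.erase a, #{c ∈ V | R b c} ≤ #{c ∈ V.erase a | R b c} +
        if R a b then 1 else 0 := by
      intro b _
      rw [← insert_erase ha, filter_insert, erase_insert (notMem_erase a V)]
      split_ifs with hba hab hab
      · exact card_insert_le _ _
      · exact (hab (hsymm _ _ hba)).elim
      · omega
      · omega
    have h3 : ∑ b ∈ V.erase a, (if R a b then 1 else 0) ≤ #{b ∈ V | R a b} := by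
      rw [sum_boole]
      exact card_le_card (filter_subset_filter _ (erase_subset _ _))
    rw [← add_sum_erase V _ ha]
    have h4 := sum_le_sum h2
    rw [sum_add_distrib] at h4
    calc _ ≤ t + (2 * n * t + t) := add_le_add hat (h4.trans (add_le_add h1 (h3.trans hat)))
      _ = _ := by ring

theorem sq_mul_lt_two_pow {D : ℕ} (hD : 21 ≤ D) : 2916 * (D + 1) ^ 2 < 2 ^ D := by
  induction D, hD using Nat.le_induction with
  | base => norm_num
  | succ n hn ih =>
    rw [pow_succ 2]
    nlinarith

theorem IncRel.symm {F : Type*} [Field F] {I : Finset (F × F × F)} {v v' : F × F × F}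
    (h : IncRel I v v') : IncRel I v' v := ⟨h.2.1, h.1, h.2.2.symm⟩

variable {p : ℕ} [Fact p.Prime]

theorem exists_incRel_le (I V : Finset (ZMod p × ZMod p × ZMod p)) (B : Finset (ZMod p))
    (hV0 : V.Nonempty) (hVB : ∀ v ∈ V, v.1 ∈ B) (hy : ∀ v ∈ V, v.2.2 ≠ 0) {k₂ A : ℕ}
    (hI : ∀ b w, #{i ∈ I | i.1 = b ∧ i.2.1 - i.2.2 * b = w} ≤ k₂)
    (hA : 6000 ^ 2 * #V ≤ A ^ 2) (hp : #V ≤ p ^ 2) :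
    ∃ v ∈ V, #{v' ∈ V | IncRel I v v'} ≤ A + (#B + k₂) := by
  have hN : 0 < #V := card_pos.2 hV0
  set N := #V with hNdef
  set D := Nat.sqrt ((N - 1) / 2916) with hD
  have h1 : D ^ 2 ≤ (N - 1) / 2916 := Nat.sqrt_le' _
  have h2 : (N - 1) / 2916 < (D + 1) ^ 2 := Nat.lt_succ_sqrt' _
  have h3 : 2916 * D ^ 2 < N := by omega
  have h4 : N ≤ 2916 * (D + 1) ^ 2 := by omega
  rcases lt_or_ge D 21 with hlt | hge
  · obtain ⟨v, hv⟩ := hV0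
    refine ⟨v, hv, (card_filter_le _ _).trans ?_⟩
    have h5 : (D + 1) ^ 2 ≤ 21 ^ 2 := Nat.pow_le_pow_left (by omega) 2
    have h6 : N ≤ A := by
      by_contra! h
      nlinarith
    omega
  · have hDA : 48 * N ≤ D * A := by
      by_contra! h
      have h5 : (D + 1) ^ 2 ≤ 4 * D ^ 2 := by nlinarith
      have h6 : (D * A) ^ 2 < (48 * N) ^ 2 := Nat.pow_lt_pow_left h (by norm_num)
      have h7 : D ^ 2 * (6000 ^ 2 * N) ≤ D ^ 2 * A ^ 2 := Nat.mul_le_mul_left _ hA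
      have h8 : N * N ≤ N * (11664 * D ^ 2) := Nat.mul_le_mul_left _ (by omega)
      nlinarith
    have hDA' : 15 * D ≤ A := by
      by_contra! h
      nlinarith
    set k := ((D + 1) ^ 2 - 1) / 3 with hk
    have hk1 : 3 * k < (D + 1) ^ 2 := by
      have : 0 < (D + 1) ^ 2 := by positivity
      omega
    have hk2 : D ^ 2 ≤ 3 * k := by
      have : (D + 1) ^ 2 = D ^ 2 + 2 * D + 1 := by ring
      omega
    obtain ⟨v, hv, h⟩ := exists_low_degree_incRel I V B hVB hy hI (D := D)
      (T := A + (#B + k₂) + 1) (k := k) (by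
        intro m hm0 hm h
        rw [ZMod.natCast_eq_zero_iff] at h
        have := Nat.le_of_dvd hm0 h
        have hp2 := (Fact.out : p.Prime).two_le
        nlinarith)
      h3 (h4.trans_lt (sq_mul_lt_two_pow hge)) (by omega) (by omega) (by
        rw [← hNdef]
        have : 3 * (16 * D * N) ≤ 3 * (k * (A + (#B + k₂) + 1)) := by
          calc 3 * (16 * D * N) = D * (48 * N) := by ring
            _ ≤ D * (D * A) := Nat.mul_le_mul_left _ hDA
            _ = D ^ 2 * A := by ring
            _ ≤ (3 * k) * (A + (#B + k₂) + 1) := Nat.mul_le_mul hk2 (by omega)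
            _ = _ := by ring
        omega) hk1 (by omega)
    exact ⟨v, hv, Nat.le_of_lt_succ h⟩

/-- The number of pairs of incidences with the same ordinate. -/
theorem card_pairs_le (I : Finset (ZMod p × ZMod p × ZMod p)) (B : Finset (ZMod p))
    (M : Finset (ZMod p × ZMod p)) (hIB : I ⊆ B ×ˢ M) (hy : ∀ m ∈ M, m.2 ≠ 0) {k₂ A : ℕ}
    (hI : ∀ b w, #{i ∈ I | i.1 = b ∧ i.2.1 - i.2.2 * b = w} ≤ k₂)
    (hA : 6000 ^ 2 * (#B * #M) ≤ A ^ 2) (hp : #B * #M ≤ p ^ 2) :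
    #{q ∈ I ×ˢ I | q.1.2.1 - q.1.2.2 * q.1.1 = q.2.2.1 - q.2.2.2 * q.2.1} ≤
      2 * (#B * #M) * (A + (#B + k₂)) := by
  rw [← card_product]
  refine le_trans ?_ (sum_card_related_le (IncRel I) (fun _ _ h => h.symm) (B ×ˢ M) ?_)
  · rw [← card_sigma]
    refine card_le_card_of_injOn (fun q => ⟨(q.2.1, q.1.2), (q.1.1, q.2.2)⟩) ?_ ?_
    · intro q hq
      obtain ⟨hq1, hq2⟩ := mem_filter.1 hq
      obtain ⟨hq3, hq4⟩ := mem_product.1 hq1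
      have h1 := mem_product.1 (hIB hq3)
      have h2 := mem_product.1 (hIB hq4)
      exact mem_sigma.2 ⟨mem_product.2 ⟨h2.1, h1.2⟩,
        mem_filter.2 ⟨mem_product.2 ⟨h1.1, h2.2⟩, hq3, hq4, hq2⟩⟩
    · rintro ⟨⟨b, m⟩, ⟨b', m'⟩⟩ - ⟨⟨c, n⟩, ⟨c', n'⟩⟩ - h
      simp only [Sigma.mk.injEq, Prod.mk.injEq, heq_eq_eq] at h
      obtain ⟨⟨rfl, rfl⟩, rfl, rfl⟩ := h
      rfl
  · intro U hU hU0
    have hcard : #U ≤ #B * #M := by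
      rw [← card_product]; exact card_le_card hU
    exact exists_incRel_le I U B hU0 (fun v hv => (mem_product.1 (hU hv)).1)
      (fun v hv => hy _ (mem_product.1 (hU hv)).2) hI
      ((Nat.mul_le_mul_left _ hcard).trans hA) (hcard.trans hp)

theorem sq_card_le_mul_card_pairs {α β : Type*} [DecidableEq β] (I : Finset α) (w : α → β)
    (W : Finset β) (hw : ∀ i ∈ I, w i ∈ W) :
    #I ^ 2 ≤ #W * #{q ∈ I ×ˢ I | w q.1 = w q.2} := by
  have h1 : #I = ∑ c ∈ W, #{i ∈ I | w i = c} := card_eq_sum_card_fiberwise hw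
  have h2 : #{q ∈ I ×ˢ I | w q.1 = w q.2} = ∑ c ∈ W, #{i ∈ I | w i = c} ^ 2 := by
    rw [card_eq_sum_card_fiberwise (t := W) (f := fun q => w q.1)
      fun q hq => hw _ (mem_product.1 (mem_filter.1 hq).1).1]
    refine sum_congr rfl fun c _ => ?_
    rw [sq, ← card_product]
    congr 1
    ext q
    simp only [mem_filter, mem_product]
    constructor
    · rintro ⟨⟨⟨h1, h2⟩, h3⟩, h4⟩
      exact ⟨⟨h1, h4⟩, h2, h3 ▸ h4⟩
    · rintro ⟨⟨h1, h2⟩, h3, h4⟩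
      exact ⟨⟨⟨h1, h3⟩, h2.trans h4.symm⟩, h2⟩
  rw [h2, h1]
  exact sq_sum_le_card_mul_sum_sq

end Energy

section Pencils

open Finset

theorem pow_bound_of_pencil_bounds {S m h A z : ℕ} (hm : 0 < m) (hh : 3 ≤ h)
    (h1 : m * (h + 1) * h ^ 2 ≤ S * (z + h))
    (h2 : (z * (h - 1)) ^ 2 ≤ h * (2 * (m * S) * (A + (m + h))))
    (hA : A ^ 2 ≤ 12000 ^ 2 * (m * S)) (h3 : m * (h + 1) * (h * (h - 1)) ≤ S ^ 2) :
    (h + 1) ^ 14 * m ≤ 10 ^ 14 * S ^ 7 := by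
  obtain ⟨g, rfl⟩ : ∃ g, h = g + 1 := ⟨h - 1, by omega⟩
  simp only [Nat.add_sub_cancel] at h2 h3
  set n := g + 1 + 1 with hn
  have hh1 : 3 * n ≤ 4 * (g + 1) := by omega
  have hh2 : n ≤ 2 * g := by omega
  have hmn3 : m * n ^ 3 ≤ 3 * S ^ 2 := by
    have e1 : 3 * n * n ≤ 4 * (g + 1) * (2 * g) := Nat.mul_le_mul hh1 hh2
    have e2 : m * n * (3 * n * n) ≤ m * n * (4 * (g + 1) * (2 * g)) := Nat.mul_le_mul_left _ e1
    nlinarith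
  rcases lt_or_ge (2 * S) (m * n * (g + 1)) with hlt | hge
  swap
  · have e1 : m * n * (3 * n) ≤ m * n * (4 * (g + 1)) := Nat.mul_le_mul_left _ hh1
    have e2 : m * n ^ 2 ≤ 3 * S := by nlinarith
    calc n ^ 14 * m = m ^ 1 * n ^ 14 := by ring
      _ ≤ m ^ 7 * n ^ 14 := Nat.mul_le_mul_right _ (Nat.pow_le_pow_right hm (by norm_num))
      _ = (m * n ^ 2) ^ 7 := by ring
      _ ≤ (3 * S) ^ 7 := Nat.pow_le_pow_left e2 7
      _ = 3 ^ 7 * S ^ 7 := by ring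
      _ ≤ _ := Nat.mul_le_mul_right _ (by norm_num)
  · have e1 : m * n ^ 3 ≤ 4 * (S * z) := by
      have k1 : 2 * S * (g + 1) ≤ m * n * (g + 1) * (g + 1) := Nat.mul_le_mul_right _ hlt.le
      have k2 : m * n * (3 * n * (3 * n)) ≤ m * n * (4 * (g + 1) * (4 * (g + 1))) :=
        Nat.mul_le_mul_left _ (Nat.mul_le_mul hh1 hh1)
      nlinarith
    have e2 : m * n ^ 4 ≤ 8 * (S * (z * g)) := by
      calc m * n ^ 4 = m * n ^ 3 * n := by ring
        _ ≤ 4 * (S * z) * (2 * g) := Nat.mul_le_mul e1 hh2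
        _ = _ := by ring
    have e3 : m * n * (m * n ^ 7) ≤ m * n * (128 * S ^ 3 * (A + (m + n))) := by
      calc m * n * (m * n ^ 7) = (m * n ^ 4) ^ 2 := by ring
        _ ≤ (8 * (S * (z * g))) ^ 2 := Nat.pow_le_pow_left e2 2
        _ = 64 * S ^ 2 * (z * g) ^ 2 := by ring
        _ ≤ 64 * S ^ 2 * (n * (2 * (m * S) * (A + (m + n)))) := by
          refine Nat.mul_le_mul_left _ (h2.trans ?_)
          gcongr <;> omega
        _ = _ := by ring
    have e4 : m * n ^ 7 ≤ 128 * S ^ 3 * (A + (m + n)) :=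
      Nat.le_of_mul_le_mul_left e3 (by positivity)
    obtain ⟨hmA, hnA⟩ | ⟨hAm, hnm⟩ | ⟨hAn, hmn⟩ :
        (m ≤ A ∧ n ≤ A) ∨ (A ≤ m ∧ n ≤ m) ∨ (A ≤ n ∧ m ≤ n) := by
      clear * -
      omega
    · have e5 : m * n ^ 7 ≤ 384 * S ^ 3 * A := by
        refine e4.trans ?_
        have : 128 * S ^ 3 * (A + (m + n)) ≤ 128 * S ^ 3 * (3 * A) :=
          Nat.mul_le_mul_left _ (by clear * - hmA hnA; omega)
        linarith
      have e6 : m * (n ^ 14 * m) ≤ m * (10 ^ 14 * S ^ 7) := by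
        calc m * (n ^ 14 * m) = (m * n ^ 7) ^ 2 := by ring
          _ ≤ (384 * S ^ 3 * A) ^ 2 := Nat.pow_le_pow_left e5 2
          _ = 384 ^ 2 * S ^ 6 * A ^ 2 := by ring
          _ ≤ 384 ^ 2 * S ^ 6 * (12000 ^ 2 * (m * S)) := Nat.mul_le_mul_left _ hA
          _ = (384 ^ 2 * 12000 ^ 2) * (m * S ^ 7) := by ring
          _ ≤ 10 ^ 14 * (m * S ^ 7) := Nat.mul_le_mul_right _ (by norm_num)
          _ = _ := by ring
      exact Nat.le_of_mul_le_mul_left e6 hm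
    · have e5 : m * n ^ 7 ≤ m * (384 * S ^ 3) := by
        refine e4.trans ?_
        have : 128 * S ^ 3 * (A + (m + n)) ≤ 128 * S ^ 3 * (3 * m) :=
          Nat.mul_le_mul_left _ (by clear * - hAm hnm; omega)
        linarith
      have e6 : n ^ 7 ≤ 384 * S ^ 3 := Nat.le_of_mul_le_mul_left e5 hm
      have e7 : n ^ 4 ≤ 3 * S ^ 2 := by
        refine le_trans ?_ hmn3
        calc n ^ 4 = n * n ^ 3 := by ring
          _ ≤ m * n ^ 3 := Nat.mul_le_mul_right _ hnm
      calc n ^ 14 * m = n ^ 7 * n ^ 4 * (m * n ^ 3) := by ring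
        _ ≤ 384 * S ^ 3 * (3 * S ^ 2) * (3 * S ^ 2) := by gcongr
        _ = (384 * 3 * 3) * S ^ 7 := by ring
        _ ≤ _ := Nat.mul_le_mul_right _ (by norm_num)
    · have e5 : n * (m * n ^ 6) ≤ n * (384 * S ^ 3) := by
        have : 128 * S ^ 3 * (A + (m + n)) ≤ 128 * S ^ 3 * (3 * n) :=
          Nat.mul_le_mul_left _ (by clear * - hAn hmn; omega)
        calc n * (m * n ^ 6) = m * n ^ 7 := by ring
          _ ≤ _ := e4
          _ ≤ _ := this
          _ = _ := by ring
      have e6 : m * n ^ 6 ≤ 384 * S ^ 3 := Nat.le_of_mul_le_mul_left e5 (by omega)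
      have e7 : n ^ 2 ≤ 8 * S := by
        by_contra! hcon
        have k1 : (8 * S) ^ 3 < (n ^ 2) ^ 3 := Nat.pow_lt_pow_left hcon (by norm_num)
        have k2 : 1 * n ^ 6 ≤ m * n ^ 6 := Nat.mul_le_mul_right _ hm
        nlinarith
      calc n ^ 14 * m = m * n ^ 6 * (n ^ 2) ^ 4 := by ring
        _ ≤ 384 * S ^ 3 * (8 * S) ^ 4 := by gcongr
        _ = (384 * 8 ^ 4) * S ^ 7 := by ring
        _ ≤ _ := Nat.mul_le_mul_right _ (by norm_num)

variable {F : Type*} [Field F]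

theorem eq_of_two_points {z o l l' : F × F} (hzo : z ≠ o) (hz : z.1 = l.1 * z.2 + l.2)
    (hz' : z.1 = l'.1 * z.2 + l'.2) (ho : o.1 = l.1 * o.2 + l.2) (ho' : o.1 = l'.1 * o.2 + l'.2) :
    l = l' := by
  have h2 : z.2 - o.2 ≠ 0 := by
    intro h
    refine hzo (Prod.ext ?_ (sub_eq_zero.1 h))
    rw [hz, ho, sub_eq_zero.1 h]
  have h1 : l.1 = l'.1 := by
    apply mul_right_cancel₀ h2
    linear_combination hz' - hz - ho' + ho
  refine Prod.ext h1 ?_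
  rw [h1] at hz
  linear_combination hz' - hz

variable [DecidableEq F] {Z M : Finset (F × F)} {P : F × F → Finset (F × F)} {h : ℕ}

theorem card_mul_le_sq_of_pencils (hPM : ∀ z ∈ Z, P z ⊆ M) (hPc : ∀ z ∈ Z, #(P z) = h)
    (hP : ∀ z ∈ Z, ∀ l ∈ P z, z.1 = l.1 * z.2 + l.2) : #Z * (h * (h - 1)) ≤ #M ^ 2 := by
  have h1 : #(Z.sigma fun z => (P z).offDiag) = #Z * (h * (h - 1)) := by
    rw [card_sigma, sum_congr rfl fun z hz => by rw [offDiag_card, hPc z hz], sum_const,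
      smul_eq_mul, Nat.mul_sub_one]
  rw [← h1, sq, ← card_product]
  refine card_le_card_of_injOn (fun q => q.2) ?_ ?_
  · rintro ⟨z, l, l'⟩ hq
    obtain ⟨hz, hl⟩ := mem_sigma.1 hq
    obtain ⟨hl1, hl2, -⟩ := mem_offDiag.1 hl
    exact mem_product.2 ⟨hPM z hz hl1, hPM z hz hl2⟩
  · rintro ⟨z, l, l'⟩ hq ⟨z', k, k'⟩ hq' heq
    simp only [Prod.mk.injEq] at heq
    obtain ⟨rfl, rfl⟩ := heq
    obtain ⟨hz, hl⟩ := mem_sigma.1 hq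
    obtain ⟨hz', hl'⟩ := mem_sigma.1 hq'
    obtain ⟨hl1, hl2, hne⟩ := mem_offDiag.1 hl
    obtain ⟨hl1', hl2', -⟩ := mem_offDiag.1 hl'
    have : z = z' := by
      by_contra hzz
      exact hne (eq_of_two_points hzz (hP _ hz _ hl1) (hP _ hz _ hl2) (hP _ hz' _ hl1')
        (hP _ hz' _ hl2'))
    rw [this]

/-- The points of `Z` other than `o` sharing a line with `o`. -/
def linkedPoints (Z : Finset (F × F)) (P : F × F → Finset (F × F)) (o : F × F) :
    Finset (F × F) :=
  {z ∈ Z | z ≠ o ∧ ∃ l ∈ P o, l ∈ P z}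

theorem exists_rich_center (hZ : Z.Nonempty) (hPM : ∀ z ∈ Z, P z ⊆ M) (hPc : ∀ z ∈ Z, #(P z) = h)
    (hP : ∀ z ∈ Z, ∀ l ∈ P z, z.1 = l.1 * z.2 + l.2) :
    ∃ o ∈ Z, #Z * h ^ 2 ≤ #M * (#(linkedPoints Z P o) + h) := by
  set N : F × F → ℕ := fun l => #{z ∈ Z | l ∈ P z} with hN
  have hsum1 : ∑ l ∈ M, N l = #Z * h := by
    refine (sum_card_bipartiteAbove_eq_sum_card_bipartiteBelow (s := Z) (t := M)
      (fun z l => l ∈ P z)).symm.trans ((sum_congr rfl fun z hz => ?_).trans (sum_const_nat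
        fun z hz => hPc z hz))
    congr 1
    ext l
    exact ⟨fun hl => (mem_filter.1 hl).2, fun hl => mem_filter.2 ⟨hPM z hz hl, hl⟩⟩
  have hsum2 : ∑ o ∈ Z, ∑ l ∈ P o, N l = ∑ l ∈ M, N l ^ 2 := by
    have : ∀ o ∈ Z, ∑ l ∈ P o, N l = ∑ l ∈ M, if l ∈ P o then N l else 0 := by
      intro o ho
      rw [← sum_filter]
      refine sum_congr ?_ fun _ _ => rfl
      ext l
      exact ⟨fun hl => mem_filter.2 ⟨hPM o ho hl, hl⟩, fun hl => (mem_filter.1 hl).2⟩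
    rw [sum_congr rfl this, sum_comm]
    refine sum_congr rfl fun l _ => ?_
    rw [← sum_filter, sum_const, smul_eq_mul, sq]
  have hCS : (#Z * h) ^ 2 ≤ #M * ∑ l ∈ M, N l ^ 2 := by
    rw [← hsum1]; exact sq_sum_le_card_mul_sum_sq
  obtain ⟨o, ho, hle⟩ : ∃ o ∈ Z, #Z * h ^ 2 ≤ #M * ∑ l ∈ P o, N l := by
    apply exists_le_of_sum_le hZ
    calc ∑ _o ∈ Z, #Z * h ^ 2 = (#Z * h) ^ 2 := by rw [sum_const, smul_eq_mul]; ring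
      _ ≤ #M * ∑ l ∈ M, N l ^ 2 := hCS
      _ = _ := by rw [← hsum2, mul_sum]
  refine ⟨o, ho, hle.trans (Nat.mul_le_mul_left _ ?_)⟩
  have hcard : ∑ l ∈ P o, #{z ∈ Z | z ≠ o ∧ l ∈ P z} ≤ #(linkedPoints Z P o) := by
    rw [← card_sigma]
    refine card_le_card_of_injOn (fun q => q.2) ?_ ?_
    · rintro ⟨l, z⟩ hq
      obtain ⟨hl, hz⟩ := mem_sigma.1 hq
      obtain ⟨hz1, hz2, hz3⟩ := mem_filter.1 hz
      exact mem_filter.2 ⟨hz1, hz2, l, hl, hz3⟩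
    · rintro ⟨l, z⟩ hq ⟨l', z'⟩ hq' heq
      simp only at heq
      subst heq
      obtain ⟨hl, hz⟩ := mem_sigma.1 hq
      obtain ⟨hl', hz'⟩ := mem_sigma.1 hq'
      obtain ⟨hz1, hz2, hz3⟩ := mem_filter.1 hz
      obtain ⟨-, -, hz3'⟩ := mem_filter.1 hz'
      have hll : l = l' := eq_of_two_points hz2 (hP _ hz1 _ hz3) (hP _ hz1 _ hz3') (hP _ ho _ hl) (hP _ ho _ hl')
      rw [hll]
  have hN1 : ∀ l ∈ P o, N l ≤ #{z ∈ Z | z ≠ o ∧ l ∈ P z} + 1 := by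
    intro l _
    refine le_trans (card_le_card ?_) (card_insert_le o _)
    intro z hz
    obtain ⟨hz1, hz2⟩ := mem_filter.1 hz
    by_cases hzo : z = o
    · exact mem_insert.2 (Or.inl hzo)
    · exact mem_insert_of_mem (mem_filter.2 ⟨hz1, hzo, hz2⟩)
  calc ∑ l ∈ P o, N l ≤ ∑ l ∈ P o, (#{z ∈ Z | z ≠ o ∧ l ∈ P z} + 1) := sum_le_sum hN1
    _ = ∑ l ∈ P o, #{z ∈ Z | z ≠ o ∧ l ∈ P z} + h := by
      rw [sum_add_distrib, sum_const, smul_eq_mul, mul_one, hPc o ho]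
    _ ≤ _ := Nat.add_le_add_right hcard h

end Pencils

section Incidences

open Finset

variable {p : ℕ} [Fact p.Prime] {Z M : Finset (ZMod p × ZMod p)}
  {P : ZMod p × ZMod p → Finset (ZMod p × ZMod p)} {h : ℕ}

/-- The map sending a point `z` and a line `l` through it to their coordinates after the
projective transformation taking `o` to a point at infinity. -/
def projPair (o : ZMod p × ZMod p) (q : (_ : ZMod p × ZMod p) × (ZMod p × ZMod p)) :
    ZMod p × ZMod p × ZMod p :=
  ((q.1.2 - o.2)⁻¹, q.2.1, o.1 - q.2.1 * o.2 - q.2.2)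

theorem projPair_apply_sub {o z l : ZMod p × ZMod p} (hz : z.1 = l.1 * z.2 + l.2)
    (h2 : z.2 - o.2 ≠ 0) :
    (projPair o ⟨z, l⟩).2.1 - (projPair o ⟨z, l⟩).2.2 * (projPair o ⟨z, l⟩).1 =
      (z.1 - o.1) * (z.2 - o.2)⁻¹ := by
  simp only [projPair]
  field_simp
  rw [hz]
  ring

theorem eq_of_inv_sub_eq {o z z' : ZMod p × ZMod p} (h2 : z'.2 - o.2 ≠ 0)
    (hb : (z.2 - o.2)⁻¹ = (z'.2 - o.2)⁻¹)
    (hw : (z.1 - o.1) * (z.2 - o.2)⁻¹ = (z'.1 - o.1) * (z'.2 - o.2)⁻¹) : z = z' := by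
  rw [hb] at hw
  have h1 := sub_left_inj.1 (mul_right_cancel₀ (inv_ne_zero h2) hw)
  exact Prod.ext h1 (sub_left_inj.1 (inv_injective hb))

theorem snd_sub_ne_zero_of_mem_linkedPoints {o z : ZMod p × ZMod p} (ho : o ∈ Z)
    (hP : ∀ z ∈ Z, ∀ l ∈ P z, z.1 = l.1 * z.2 + l.2) (hz : z ∈ linkedPoints Z P o) :
    z.2 - o.2 ≠ 0 := by
  obtain ⟨hzZ, hzo, l, hlo, hlz⟩ := mem_filter.1 hz
  intro h0
  refine hzo (Prod.ext ?_ (sub_eq_zero.1 h0))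
  rw [hP z hzZ l hlz, hP o ho l hlo, sub_eq_zero.1 h0]

theorem sq_card_linkedPoints_mul_le {Y : Finset (ZMod p)} {o : ZMod p × ZMod p} {A : ℕ}
    (hZY : ∀ z ∈ Z, z.2 ∈ Y) (hPM : ∀ z ∈ Z, P z ⊆ M) (hPc : ∀ z ∈ Z, #(P z) = h)
    (hP : ∀ z ∈ Z, ∀ l ∈ P z, z.1 = l.1 * z.2 + l.2) (ho : o ∈ Z)
    (hA : 6000 ^ 2 * (#Y * #M) ≤ A ^ 2) (hp : #Y * #M ≤ p ^ 2) :
    (#(linkedPoints Z P o) * (h - 1)) ^ 2 ≤ h * (2 * (#Y * #M) * (A + (#Y + h))) := by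
  set T := linkedPoints Z P o with hT
  have hTZ : ∀ z ∈ T, z ∈ Z := fun z hz => (mem_filter.1 hz).1
  have h2 : ∀ z ∈ T, z.2 - o.2 ≠ 0 := fun z hz => snd_sub_ne_zero_of_mem_linkedPoints ho hP hz
  set J := T.sigma fun z => {l ∈ P z | o.1 ≠ l.1 * o.2 + l.2} with hJ
  set I := J.image (projPair o) with hI
  set B := Y.image fun y => (y - o.2)⁻¹ with hB
  set N := {l ∈ M | o.1 ≠ l.1 * o.2 + l.2}.image fun l => (l.1, o.1 - l.1 * o.2 - l.2) with hN
  have hBc : #B ≤ #Y := card_image_le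
  have hNc : #N ≤ #M := card_image_le.trans (card_filter_le _ _)
  have hBN : #B * #N ≤ #Y * #M := Nat.mul_le_mul hBc hNc
  have hw : ∀ q ∈ J, (projPair o q).2.1 - (projPair o q).2.2 * (projPair o q).1 =
      (q.1.1 - o.1) * (q.1.2 - o.2)⁻¹ := by
    rintro ⟨z, l⟩ hq
    obtain ⟨hz, hl⟩ := mem_sigma.1 hq
    exact projPair_apply_sub (hP z (hTZ z hz) l (mem_filter.1 hl).1) (h2 z hz)
  have hIBN : I ⊆ B ×ˢ N := by
    intro i hi
    obtain ⟨⟨z, l⟩, hq, rfl⟩ := mem_image.1 hi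
    obtain ⟨hz, hl⟩ := mem_sigma.1 hq
    obtain ⟨hl, hne⟩ := mem_filter.1 hl
    exact mem_product.2 ⟨mem_image.2 ⟨z.2, hZY z (hTZ z hz), rfl⟩,
      mem_image.2 ⟨l, mem_filter.2 ⟨hPM z (hTZ z hz) hl, hne⟩, rfl⟩⟩
  have hNy : ∀ m ∈ N, m.2 ≠ 0 := by
    intro m hm
    obtain ⟨l, hl, rfl⟩ := mem_image.1 hm
    intro h0
    refine (mem_filter.1 hl).2 ?_
    simp only at h0
    linear_combination h0
  have hfib : ∀ b w, #{i ∈ I | i.1 = b ∧ i.2.1 - i.2.2 * b = w} ≤ h := by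
    intro b w
    rcases ({i ∈ I | i.1 = b ∧ i.2.1 - i.2.2 * b = w}).eq_empty_or_nonempty with he | ⟨i, hi⟩
    · rw [he, card_empty]; exact Nat.zero_le _
    obtain ⟨hi, hib, hiw⟩ := mem_filter.1 hi
    obtain ⟨⟨z, l⟩, hq, rfl⟩ := mem_image.1 hi
    have hz := (mem_sigma.1 hq).1
    have hzw := hw _ hq
    rw [← hPc z (hTZ z hz)]
    refine (card_le_card ?_).trans (card_image_le (s := P z) (f := fun l => projPair o ⟨z, l⟩))
    intro i hi'
    obtain ⟨hi', hib', hiw'⟩ := mem_filter.1 hi'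
    obtain ⟨⟨z', l'⟩, hq', rfl⟩ := mem_image.1 hi'
    obtain ⟨hz', hl'⟩ := mem_sigma.1 hq'
    have hzw' := hw _ hq'
    rw [hib, hiw] at hzw
    rw [hib', hiw'] at hzw'
    have hzz : z' = z := eq_of_inv_sub_eq (h2 z hz) (hib'.trans hib.symm) (hzw'.symm.trans hzw)
    subst hzz
    exact mem_image.2 ⟨l', (mem_filter.1 hl').1, rfl⟩
  have hE := card_pairs_le I B N hIBN hNy hfib ((Nat.mul_le_mul_left _ hBN).trans hA)
    (hBN.trans hp)
  have hIW : ∀ i ∈ I, i.2.1 - i.2.2 * i.1 ∈ (P o).image Prod.fst := by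
    intro i hi
    obtain ⟨⟨z, l⟩, hq, rfl⟩ := mem_image.1 hi
    have hz := (mem_sigma.1 hq).1
    rw [hw _ hq]
    obtain ⟨hzZ, -, k, hko, hkz⟩ := mem_filter.1 hz
    refine mem_image.2 ⟨k, hko, ?_⟩
    have h3 := h2 z hz
    have h4 : z.1 - o.1 = k.1 * (z.2 - o.2) := by
      rw [hP z hzZ k hkz, hP o ho k hko]; ring
    simp only [h4]
    field_simp
  have hE' := sq_card_le_mul_card_pairs I (fun i => i.2.1 - i.2.2 * i.1) _ hIW
  have hWc : #((P o).image Prod.fst) ≤ h := card_image_le.trans (hPc o ho).le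
  have hIJ : #I = #J := by
    refine card_image_of_injOn ?_
    rintro ⟨z, l⟩ hq ⟨z', l'⟩ hq' heq
    have hz := (mem_sigma.1 hq).1
    have hz' := (mem_sigma.1 hq').1
    have hww := hw _ hq
    rw [heq, hw _ hq'] at hww
    have hzz : z = z' := eq_of_inv_sub_eq (h2 z' hz') (congrArg Prod.fst heq) hww.symm
    simp only [projPair, Prod.mk.injEq] at heq
    obtain ⟨-, h5, h6⟩ := heq
    have hll : l = l' := by
      refine Prod.ext h5 ?_
      rw [h5] at h6
      exact sub_right_injective h6
    rw [hzz, hll]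
  have hJc : #T * (h - 1) ≤ #J := by
    rw [hJ, card_sigma, ← smul_eq_mul, ← sum_const]
    refine sum_le_sum fun z hz => ?_
    have hsub : #{l ∈ P z | ¬ o.1 ≠ l.1 * o.2 + l.2} ≤ 1 := by
      refine card_le_one.2 fun l hl l' hl' => ?_
      obtain ⟨hl1, hl2⟩ := mem_filter.1 hl
      obtain ⟨hl1', hl2'⟩ := mem_filter.1 hl'
      exact eq_of_two_points (mem_filter.1 hz).2.1 (hP z (hTZ z hz) l hl1)
        (hP z (hTZ z hz) l' hl1') (not_not.1 hl2) (not_not.1 hl2')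
    have := card_filter_add_card_filter_not (s := P z) (fun l => o.1 ≠ l.1 * o.2 + l.2)
    rw [hPc z (hTZ z hz)] at this
    omega
  calc (#T * (h - 1)) ^ 2 ≤ #I ^ 2 := Nat.pow_le_pow_left (hJc.trans hIJ.ge) 2
    _ ≤ _ := hE'
    _ ≤ h * (2 * (#B * #N) * (A + (#B + h))) := Nat.mul_le_mul hWc hE
    _ ≤ _ := by gcongr

theorem card_pow_le_of_rich_points {Y : Finset (ZMod p)} (hZY : ∀ z ∈ Z, z.2 ∈ Y)
    (hY : 0 < #Y) (hZ : #Z = #Y * (h + 1)) (hh : 3 ≤ h)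
    (hrich : ∀ z ∈ Z, h ≤ #{l ∈ M | z.1 = l.1 * z.2 + l.2}) (hp : #Y * #M ≤ p ^ 2) :
    (h + 1) ^ 14 * #Y ≤ 10 ^ 14 * #M ^ 7 := by
  have hex : ∀ z, ∃ Q : Finset (ZMod p × ZMod p),
      z ∈ Z → Q ⊆ {l ∈ M | z.1 = l.1 * z.2 + l.2} ∧ #Q = h := by
    intro z
    by_cases hz : z ∈ Z
    · obtain ⟨Q, h1, h2⟩ := exists_subset_card_eq (hrich z hz)
      exact ⟨Q, fun _ => ⟨h1, h2⟩⟩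
    · exact ⟨∅, fun hz' => absurd hz' hz⟩
  choose P hQ using hex
  have hPM : ∀ z ∈ Z, P z ⊆ M := fun z hz => (hQ z hz).1.trans (filter_subset _ _)
  have hPc : ∀ z ∈ Z, #(P z) = h := fun z hz => (hQ z hz).2
  have hP : ∀ z ∈ Z, ∀ l ∈ P z, z.1 = l.1 * z.2 + l.2 :=
    fun z hz l hl => (mem_filter.1 ((hQ z hz).1 hl)).2
  have hZne : Z.Nonempty := card_pos.1 (by rw [hZ]; positivity)
  obtain ⟨o, ho, h1⟩ := exists_rich_center hZne hPM hPc hP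
  have hM : 0 < #M := by
    have := card_le_card (hPM o ho)
    rw [hPc o ho] at this
    omega
  have hYM : 0 < #Y * #M := Nat.mul_pos hY hM
  set r := Nat.sqrt (#Y * #M) with hr
  have hr1 : #Y * #M < (r + 1) * (r + 1) := Nat.lt_succ_sqrt _
  have hr2 : r * r ≤ #Y * #M := Nat.sqrt_le _
  have hr3 : 0 < r := Nat.sqrt_pos.2 hYM
  have hA1 : 6000 ^ 2 * (#Y * #M) ≤ (6000 * (r + 1)) ^ 2 := by nlinarith
  have hA2 : (6000 * (r + 1)) ^ 2 ≤ 12000 ^ 2 * (#Y * #M) := by nlinarith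
  rw [hZ] at h1
  have h3 := card_mul_le_sq_of_pencils hPM hPc hP
  rw [hZ] at h3
  exact pow_bound_of_pencil_bounds hY hh h1
    (sq_card_linkedPoints_mul_le hZY hPM hPc hP ho hA1 hp) hA2 h3

end Incidences

section Lines

variable {F : Type*} [Field F]

theorem IsLine.eq_setOf {ℓ : Set (F × F)} (hℓ : IsLine ℓ) {z z' : F × F} (hz : z ∈ ℓ)
    (hz' : z' ∈ ℓ) (hne : z ≠ z') :
    ℓ = {w | (w.1 - z.1) * (z'.2 - z.2) = (w.2 - z.2) * (z'.1 - z.1)} := by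
  obtain ⟨a, b, c, hab, rfl⟩ := hℓ
  simp only [Set.mem_ofPred_eq] at hz hz'
  ext w
  simp only [Set.mem_ofPred_eq]
  constructor
  · intro hw
    rcases hab with h | h
    · apply mul_left_cancel₀ h
      linear_combination (z'.2 - z.2) * (hw - hz) - (w.2 - z.2) * (hz' - hz)
    · apply mul_left_cancel₀ h
      linear_combination (w.1 - z.1) * (hz' - hz) - (z'.1 - z.1) * (hw - hz)
  · intro hw
    by_cases hu : z'.1 - z.1 = 0
    · have hv : z'.2 - z.2 ≠ 0 := fun hv =>
        hne (Prod.ext (sub_eq_zero.1 hu).symm (sub_eq_zero.1 hv).symm)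
      apply mul_left_cancel₀ hv
      linear_combination (w.2 - z.2) * (hz' - hz) + a * hw + (z'.2 - z.2) * hz
    · apply mul_left_cancel₀ hu
      linear_combination (w.1 - z.1) * (hz' - hz) - b * hw + (z'.1 - z.1) * hz

theorem IsLine.eq_of_two_points {ℓ ℓ' : Set (F × F)} (hℓ : IsLine ℓ) (hℓ' : IsLine ℓ')
    {z z' : F × F} (hz : z ∈ ℓ) (hz' : z' ∈ ℓ) (hzℓ' : z ∈ ℓ') (hzℓ'' : z' ∈ ℓ')
    (hne : z ≠ z') : ℓ = ℓ' :=
  (hℓ.eq_setOf hz hz' hne).trans (hℓ'.eq_setOf hzℓ' hzℓ'' hne).symm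

theorem ncard_le_sq_of_two_lines [Finite F] {Z : Set (F × F)} {L : Set (Set (F × F))}
    (hL : ∀ ℓ ∈ L, IsLine ℓ) (hZ : ∀ z ∈ Z, 2 ≤ ({ℓ ∈ L | z ∈ ℓ}).ncard) :
    Z.ncard ≤ L.ncard ^ 2 := by
  have hex : ∀ z, ∃ q : Set (F × F) × Set (F × F),
      z ∈ Z → (q.1 ∈ L ∧ z ∈ q.1) ∧ (q.2 ∈ L ∧ z ∈ q.2) ∧ q.1 ≠ q.2 := by
    intro z
    by_cases hz : z ∈ Z
    · obtain ⟨ℓ, ℓ', h1, h2, hne⟩ := (Set.one_lt_ncard_iff (Set.toFinite _)).1 (hZ z hz)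
      exact ⟨(ℓ, ℓ'), fun _ => ⟨h1, h2, hne⟩⟩
    · exact ⟨(∅, ∅), fun hz' => absurd hz' hz⟩
  choose f hf using hex
  rw [sq, ← Set.ncard_prod]
  refine Set.ncard_le_ncard_of_injOn f (fun z hz => ⟨(hf z hz).1.1, (hf z hz).2.1.1⟩) ?_
    (Set.toFinite _)
  intro z hz z' hz' heq
  by_contra hne
  obtain ⟨⟨h1, h2⟩, ⟨h3, h4⟩, h5⟩ := hf z hz
  obtain ⟨⟨-, h2'⟩, ⟨-, h4'⟩, -⟩ := hf z' hz'
  rw [← heq] at h2' h4'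
  exact h5 ((hL _ h1).eq_of_two_points (hL _ h3) h2 h2' h4 h4' hne)

/-- The line `x = l.1 * y + l.2`. -/
def slopeLine (l : F × F) : Set (F × F) :=
  {z | z.1 = l.1 * z.2 + l.2}

theorem slopeLine_injective : Function.Injective (slopeLine (F := F)) := by
  intro l l' h
  have h0 : (l.2, (0 : F)) ∈ slopeLine l' := h ▸ (by simp [slopeLine])
  have h1 : (l.1 + l.2, (1 : F)) ∈ slopeLine l' := h ▸ (by simp [slopeLine])
  simp only [slopeLine, Set.mem_ofPred_eq, mul_zero, zero_add, mul_one] at h0 h1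
  refine Prod.ext ?_ h0
  rw [h0] at h1
  exact add_right_cancel h1

theorem IsLine.eq_slopeLine_or {ℓ : Set (F × F)} (hℓ : IsLine ℓ) {z : F × F} (hz : z ∈ ℓ) :
    (∃ l, ℓ = slopeLine l) ∨ ℓ = {w | w.2 = z.2} := by
  obtain ⟨a, b, c, hab, rfl⟩ := hℓ
  simp only [Set.mem_ofPred_eq] at hz
  by_cases ha : a = 0
  · subst ha
    right
    have hb : b ≠ 0 := hab.resolve_left fun h => h rfl
    ext w
    simp only [zero_mul, zero_add] at hz
    simp only [Set.mem_ofPred_eq, zero_mul, zero_add, ← hz]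
    exact mul_right_inj' hb
  · left
    refine ⟨(-b / a, c / a), ?_⟩
    ext w
    simp only [slopeLine, Set.mem_ofPred_eq]
    field_simp
    constructor
    · intro h; linear_combination h
    · intro h; linear_combination h

theorem ncard_le_ncard_slopeLine_add_one [Finite F] {L : Set (Set (F × F))}
    (hL : ∀ ℓ ∈ L, IsLine ℓ) (z : F × F) :
    ({ℓ ∈ L | z ∈ ℓ}).ncard ≤ ({l | slopeLine l ∈ L ∧ z ∈ slopeLine l}).ncard + 1 := by
  have hsub : {ℓ ∈ L | z ∈ ℓ} ⊆
      insert {w | w.2 = z.2} (slopeLine '' {l | slopeLine l ∈ L ∧ z ∈ slopeLine l}) := by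
    rintro ℓ ⟨hℓ, hz⟩
    rcases (hL ℓ hℓ).eq_slopeLine_or hz with ⟨l, rfl⟩ | h
    · exact Or.inr ⟨l, ⟨hℓ, hz⟩, rfl⟩
    · exact Or.inl h
  calc _ ≤ _ := Set.ncard_le_ncard hsub (Set.toFinite _)
    _ ≤ _ := Set.ncard_insert_le _ _
    _ ≤ _ := Nat.add_le_add_right (Set.ncard_image_le (Set.toFinite _)) 1

end Lines

theorem ncard_biUnion_prod_singleton {F : Type*} [Finite F] {Y : Set F} {X : F → Set F} {n : ℕ}
    (hX : ∀ y ∈ Y, (X y).ncard = n) :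
    (⋃ y ∈ Y, X y ×ˢ ({y} : Set F)).ncard = Y.ncard * n := by
  classical
  have := Fintype.ofFinite F
  have h1 : (⋃ y ∈ Y, X y ×ˢ ({y} : Set F)) =
      ((Y.toFinset.sigma fun y => (X y).toFinset).image fun q => (q.2, q.1) :
        Finset (F × F)) := by
    ext ⟨x, y⟩
    simp
    grind
  rw [h1, Set.ncard_coe_finset, Finset.card_image_of_injective, Finset.card_sigma,
    Set.ncard_eq_toFinset_card' Y]
  · refine Finset.sum_const_nat fun y hy => ?_
    rw [← hX y (Set.mem_toFinset.1 hy), Set.ncard_eq_toFinset_card']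
  · rintro ⟨y, x⟩ ⟨y', x'⟩ h
    simp only [Prod.mk.injEq] at h
    obtain ⟨rfl, rfl⟩ := h
    rfl

theorem pow_mul_ncard_le {p : ℕ} [Fact p.Prime] {n : ℕ} {Y : Set (ZMod p)}
    {X : ZMod p → Set (ZMod p)} {L : Set (Set (ZMod p × ZMod p))} (hn : 2 ≤ n)
    (hY : 0 < Y.ncard) (hX : ∀ y ∈ Y, (X y).ncard = n) (hL : ∀ ℓ ∈ L, IsLine ℓ)
    (hp : Y.ncard * L.ncard ≤ p ^ 2)
    (hrich : ∀ z ∈ ⋃ y ∈ Y, X y ×ˢ ({y} : Set (ZMod p)), n ≤ ({ℓ ∈ L | z ∈ ℓ}).ncard) :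
    n ^ 14 * Y.ncard ≤ 10 ^ 14 * L.ncard ^ 7 := by
  classical
  have hZ := ncard_biUnion_prod_singleton hX
  set Z := ⋃ y ∈ Y, X y ×ˢ ({y} : Set (ZMod p)) with hZdef
  rcases Nat.lt_or_ge 3 n with h3 | h3
  · obtain ⟨h, rfl⟩ : ∃ h, n = h + 1 := ⟨n - 1, by omega⟩
    set M : Finset (ZMod p × ZMod p) := {l | slopeLine l ∈ L} with hM
    have hML : M.card ≤ L.ncard := by
      rw [← Set.ncard_coe_finset]
      exact Set.ncard_le_ncard_of_injOn slopeLine (fun l hl => (Finset.mem_filter.1 hl).2)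
        slopeLine_injective.injOn (Set.toFinite _)
    have hmain := card_pow_le_of_rich_points (Z := Z.toFinset) (M := M) (Y := Y.toFinset)
      (h := h) ?_ ?_ ?_ (by omega) ?_ ?_
    · rw [← Set.ncard_eq_toFinset_card'] at hmain
      exact hmain.trans (Nat.mul_le_mul_left _ (Nat.pow_le_pow_left hML 7))
    · intro z hz
      rw [Set.mem_toFinset, hZdef] at hz
      simp only [Set.mem_iUnion, Set.mem_prod, Set.mem_singleton_iff] at hz
      obtain ⟨y, hy, -, hzy⟩ := hz
      rw [Set.mem_toFinset, hzy]
      exact hy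
    · rwa [← Set.ncard_eq_toFinset_card']
    · rw [← Set.ncard_eq_toFinset_card', ← Set.ncard_eq_toFinset_card', hZ]
    · intro z hz
      have h1 := (hrich z (Set.mem_toFinset.1 hz)).trans (ncard_le_ncard_slopeLine_add_one hL z)
      refine (Nat.le_of_add_le_add_right h1).trans_eq ?_
      rw [← Set.ncard_coe_finset]
      congr 1
      ext l
      simp only [hM, Finset.coe_filter, Finset.mem_filter, Finset.mem_univ, true_and]
      exact Iff.rfl
    · rw [← Set.ncard_eq_toFinset_card']
      exact (Nat.mul_le_mul_left _ hML).trans hp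
  · have h1 := ncard_le_sq_of_two_lines hL fun z hz => hn.trans (hrich z hz)
    rw [hZ] at h1
    have hS : 0 < L.ncard := by
      rcases Nat.eq_zero_or_pos L.ncard with h0 | h0
      · rw [h0] at h1
        have := Nat.mul_pos hY (show 0 < n by omega)
        omega
      · exact h0
    calc n ^ 14 * Y.ncard = n ^ 13 * (Y.ncard * n) := by ring
      _ ≤ 3 ^ 13 * L.ncard ^ 2 := Nat.mul_le_mul (Nat.pow_le_pow_left h3 13) h1
      _ ≤ _ := Nat.mul_le_mul (by norm_num) (Nat.pow_le_pow_right hS (by norm_num))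

/-- if $|Y| = p^τ$, each $|X_y| = p^s$, $|Y||L| \le c p^2$, and every
point of $Z = \bigcup_{y \in Y} X_y \times \{y\}$ is $p^s$-rich with respect to $L$,
then $|L| \ge C p^{2s + τ/7}$. -/
theorem statement7 :
    ∃ c K : ℝ, 0 < c ∧ 0 < K ∧
      ∀ (p : ℕ) [Fact p.Prime] (s τ : ℝ) (Y : Set (ZMod p))
        (Xy : ZMod p → Set (ZMod p)) (L : Set (Set (ZMod p × ZMod p)))
        (Z : Set (ZMod p × ZMod p)),
        0 < s → s < 1 → 0 < τ →
        (Y.ncard : ℝ) = (p : ℝ) ^ τ →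
        (∀ y ∈ Y, ((Xy y).ncard : ℝ) = (p : ℝ) ^ s) →
        Z = ⋃ y ∈ Y, Xy y ×ˢ ({y} : Set (ZMod p)) →
        (∀ ℓ ∈ L, IsLine ℓ) →
        (Y.ncard : ℝ) * (L.ncard : ℝ) ≤ c * (p : ℝ) ^ (2 : ℕ) →
        (∀ z ∈ Z, (p : ℝ) ^ s ≤ (({ℓ ∈ L | z ∈ ℓ}).ncard : ℝ)) →
        K * (p : ℝ) ^ (2 * s + τ / 7) ≤ (L.ncard : ℝ) := by
  refine ⟨1, 1 / 100, one_pos, by norm_num, ?_⟩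
  rintro p hprime s τ Y Xy L Z hs - hτ hY hX rfl hL hp hrich
  have hp1 : (1 : ℝ) < p := by exact_mod_cast hprime.out.one_lt
  have hp0 : (0 : ℝ) ≤ p := by positivity
  have hY0 : 0 < Y.ncard := by
    have : (1 : ℝ) < Y.ncard := hY ▸ Real.one_lt_rpow hp1 hτ
    exact_mod_cast one_pos.trans this
  obtain ⟨y₀, hy₀⟩ := Set.nonempty_of_ncard_ne_zero hY0.ne'
  set n := (Xy y₀).ncard
  have hn : (n : ℝ) = (p : ℝ) ^ s := hX y₀ hy₀
  have hn2 : 2 ≤ n := by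
    have : (1 : ℝ) < n := hn ▸ Real.one_lt_rpow hp1 hs
    exact_mod_cast this
  have hmain : n ^ 14 * Y.ncard ≤ 10 ^ 14 * L.ncard ^ 7 := by
    refine pow_mul_ncard_le hn2 hY0 (X := Xy) (fun y hy => ?_) hL ?_ fun z hz => ?_
    · exact_mod_cast (hX y hy).trans hn.symm
    · rw [one_mul] at hp
      exact_mod_cast hp
    · have := hrich z hz
      rw [← hn] at this
      exact_mod_cast this
  have hpow : ((p : ℝ) ^ (2 * s + τ / 7)) ^ 7 ≤ (100 * (L.ncard : ℝ)) ^ 7 := by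
    calc ((p : ℝ) ^ (2 * s + τ / 7)) ^ 7 = (p : ℝ) ^ (s * (14 : ℕ) + τ) := by
          rw [← Real.rpow_natCast, ← Real.rpow_mul hp0]
          congr 1
          push_cast
          ring
      _ = (n : ℝ) ^ 14 * Y.ncard := by
          rw [Real.rpow_add (by linarith), Real.rpow_mul_natCast hp0, hn, hY]
      _ ≤ 10 ^ 14 * (L.ncard : ℝ) ^ 7 := by exact_mod_cast hmain
      _ = _ := by ring
  have := le_of_pow_le_pow_left₀ (by norm_num) (by positivity) hpow
  linarith
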